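/- Let p > 2, N ≥ 1 and r < 1. There exists a constant C depending only on p, N, r such that for every f continuous on closure(B₁) and every bounded continuous function u : B₁ → ℝ that is a viscosity solution of Σᵢ₌₁ᴺ |∂ᵢu|^{p-2} ∂ᵢᵢu = f in B₁ (equivalently of Σᵢ ∂ᵢ(|∂ᵢu|^{p-2}∂ᵢu) = (p−1) f), one has, for all x, y ∈ B_r: |u(x) − u(y)| ≤ C (‖u‖_{L^∞(B₁)} + ‖f‖_{L^∞(B₁)}^{1/(p−1)}) |x − y|. -/

import Mathlib

open Metric MeasureTheory Topology Filter Set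
/-- The pseudo-p-Laplacian operator (non-divergence form)
`Σᵢ |∂ᵢφ(x)|^(p-2) ∂ᵢᵢφ(x)` applied to a test function `φ` at `x`. -/
noncomputable def pseudoPOp (p : ℝ) {N : ℕ} (φ : EuclideanSpace ℝ (Fin N) → ℝ)
    (x : EuclideanSpace ℝ (Fin N)) : ℝ :=
  ∑ i : Fin N, |fderiv ℝ φ x (EuclideanSpace.single i 1)| ^ (p - 2) *
    fderiv ℝ (fun y => fderiv ℝ φ y (EuclideanSpace.single i 1)) x (EuclideanSpace.single i 1)

/-- `u` is a viscosity subsolution of `Σᵢ |∂ᵢu|^(p-2) ∂ᵢᵢu = f` on `Ω`: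
for every `x₀ ∈ Ω` and every `φ` which is `C²` in a neighborhood of `x₀` such that
`u - φ` has a local maximum equal to `0` at `x₀`, one has `Σᵢ |∂ᵢφ(x₀)|^(p-2) ∂ᵢᵢφ(x₀) ≥ f(x₀)`. -/
def IsViscSubsol (p : ℝ) {N : ℕ} (Ω : Set (EuclideanSpace ℝ (Fin N)))
    (u f : EuclideanSpace ℝ (Fin N) → ℝ) : Prop :=
  ∀ x₀ ∈ Ω, ∀ φ : EuclideanSpace ℝ (Fin N) → ℝ,
    (∃ ε > 0, ContDiffOn ℝ 2 φ (ball x₀ ε)) →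
    u x₀ = φ x₀ → (∀ᶠ x in 𝓝 x₀, u x ≤ φ x) →
    f x₀ ≤ pseudoPOp p φ x₀

/-- `u` is a viscosity supersolution of `Σᵢ |∂ᵢu|^(p-2) ∂ᵢᵢu = f` on `Ω`. -/
def IsViscSupersol (p : ℝ) {N : ℕ} (Ω : Set (EuclideanSpace ℝ (Fin N)))
    (u f : EuclideanSpace ℝ (Fin N) → ℝ) : Prop :=
  ∀ x₀ ∈ Ω, ∀ φ : EuclideanSpace ℝ (Fin N) → ℝ,
    (∃ ε > 0, ContDiffOn ℝ 2 φ (ball x₀ ε)) →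
    u x₀ = φ x₀ → (∀ᶠ x in 𝓝 x₀, φ x ≤ u x) →
    pseudoPOp p φ x₀ ≤ f x₀


section JensenAlexandrov

variable {V : Type*} [NormedAddCommGroup V] [InnerProductSpace ℝ V]

/-- `ζ` is a subgradient of `g` at `z`. -/
def SubG (g : V → ℝ) (z ζ : V) : Prop := ∀ z', g z + inner ℝ ζ (z' - z) ≤ g z'

def Exp2 (w : V → ℝ) (z q : V) (T : V →L[ℝ] V) : Prop :=
  ∀ ε > 0, ∀ᶠ h in 𝓝 (0 : V), |w (z + h) - w z - inner ℝ q h - 1 / 2 * inner ℝ (T h) h| ≤ ε * ‖h‖ ^ 2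

lemma SubG.monotone {g : V → ℝ} {z ζ z' ζ' : V} (h : SubG g z ζ) (h' : SubG g z' ζ') :
    0 ≤ inner ℝ (ζ - ζ') (z - z') := by
  have h1 := h z'
  have h2 := h' z
  rw [inner_sub_left]
  have : inner ℝ ζ (z' - z) = - inner ℝ ζ (z - z') := by rw [← inner_neg_right, neg_sub]
  linarith

lemma SubG.nonexp {g : V → ℝ} {z z' y y' : V} (h : SubG g z (y - z)) (h' : SubG g z' (y' - z')) :
    ‖z - z'‖ ^ 2 ≤ inner ℝ (y - y') (z - z') := by
  have := h.monotone h'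
  have e : y - z - (y' - z') = (y - y') - (z - z') := by abel
  rw [e, inner_sub_left, real_inner_self_eq_norm_sq] at this
  linarith

lemma SubG.nonexp' {g : V → ℝ} {z z' y y' : V} (h : SubG g z (y - z)) (h' : SubG g z' (y' - z')) :
    ‖z - z'‖ ≤ ‖y - y'‖ := by
  have h1 := h.nonexp h'
  have h2 := real_inner_le_norm (y - y') (z - z')
  by_contra hc
  push Not at hc
  have := norm_nonneg (y - y')
  nlinarith

lemma convexOn_of_subG {g : V → ℝ} (hg : ∀ z, ∃ ζ, SubG g z ζ) : ConvexOn ℝ univ g := by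
  refine ⟨convex_univ, ?_⟩
  intro x _ y _ a b ha hb hab
  obtain ⟨ζ, hζ⟩ := hg (a • x + b • y)
  have h1 := hζ x
  have h2 := hζ y
  have e1 : x - (a • x + b • y) = b • (x - y) := by
    have : a = 1 - b := by linarith
    subst this; module
  have e2 : y - (a • x + b • y) = (-a) • (x - y) := by
    have : b = 1 - a := by linarith
    subst this; module
  rw [e1, inner_smul_right] at h1
  rw [e2, inner_smul_right] at h2
  simp only [smul_eq_mul]
  set I := inner ℝ ζ (x - y)
  set G := g (a • x + b • y)
  have h3 := mul_le_mul_of_nonneg_left h1 ha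
  have h4 := mul_le_mul_of_nonneg_left h2 hb
  have : G = a * G + b * G := by rw [← add_mul, hab, one_mul]
  nlinarith

variable [FiniteDimensional ℝ V]

lemma continuous_of_subG {g : V → ℝ} (hg : ∀ z, ∃ ζ, SubG g z ζ) : Continuous g := by
  have := (convexOn_of_subG hg).continuousOn isOpen_univ
  exact continuousOn_univ.1 this

lemma exists_prox {g : V → ℝ} (hg : ∀ z, ∃ ζ, SubG g z ζ) (y : V) : ∃ z, SubG g z (y - z) := by
  have hc := continuous_of_subG hg
  obtain ⟨ζ, hζ⟩ := hg y
  have hcont : Continuous (fun z => g z + 1 / 2 * ‖z - y‖ ^ 2) := by fun_prop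
  obtain ⟨z, hz⟩ : ∃ z, ∀ z', g z + 1 / 2 * ‖z - y‖ ^ 2 ≤ g z' + 1 / 2 * ‖z' - y‖ ^ 2 := by
    refine hcont.exists_forall_le' y ?_
    have : ∀ᶠ x in cocompact V, 2 * ‖ζ‖ + ‖y‖ ≤ ‖x‖ :=
      (tendsto_norm_cocompact_atTop (E := V)).eventually_ge_atTop _
    filter_upwards [this] with x hx
    have h1 := hζ x
    have h2 := abs_le.1 (abs_real_inner_le_norm ζ (x - y))
    have h3 : ‖x‖ ≤ ‖x - y‖ + ‖y‖ := by simpa using norm_add_le (x - y) y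
    have h4 : 2 * ‖ζ‖ ≤ ‖x - y‖ := by linarith
    have h5 := norm_nonneg (x - y)
    simp only [sub_self, norm_zero]
    nlinarith
  refine ⟨z, fun z' => ?_⟩
  have key : ∀ t ∈ Ioo (0 : ℝ) 1,
      g z + inner ℝ (y - z) (z' - z) - t * (1 / 2 * ‖z' - z‖ ^ 2) ≤ g z' := by
    intro t ht
    have h1 := hz (z + t • (z' - z))
    have h2 := (convexOn_of_subG hg).2 (mem_univ z) (mem_univ z') (by linarith [ht.2] : 0 ≤ 1 - t)
      ht.1.le (by ring)
    have e : (1 - t) • z + t • z' = z + t • (z' - z) := by module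
    rw [e] at h2
    simp only [smul_eq_mul] at h2
    have e2 : z + t • (z' - z) - y = (z - y) + t • (z' - z) := by abel
    rw [e2, norm_add_sq_real, inner_smul_right, norm_smul, mul_pow, Real.norm_eq_abs, sq_abs] at h1
    have e3 : inner ℝ (y - z) (z' - z) = - inner ℝ (z - y) (z' - z) := by
      rw [← inner_neg_left, neg_sub]
    rw [e3]
    have : 0 ≤ t * (g z' - g z + inner ℝ (z - y) (z' - z) + t * (1 / 2 * ‖z' - z‖ ^ 2)) := by
      nlinarith
    have := nonneg_of_mul_nonneg_right this ht.1
    linarith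
  have hlim : Tendsto (fun t : ℝ => g z + inner ℝ (y - z) (z' - z) - t * (1 / 2 * ‖z' - z‖ ^ 2))
      (𝓝[>] 0) (𝓝 (g z + inner ℝ (y - z) (z' - z))) := by
    have : Continuous (fun t : ℝ => g z + inner ℝ (y - z) (z' - z) - t * (1 / 2 * ‖z' - z‖ ^ 2)) := by
      fun_prop
    have := this.tendsto 0
    simp only [zero_mul, sub_zero] at this
    exact this.mono_left nhdsWithin_le_nhds
  exact le_of_tendsto hlim (by
    filter_upwards [Ioo_mem_nhdsGT (zero_lt_one' ℝ)] with t ht using key t ht)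

/-- Second order Taylor expansion when the gradient is differentiable at one point. -/
lemma taylor2 {e : V → ℝ} {G : V → V} {y : V} {L : V →L[ℝ] V}
    (he : ∀ᶠ x in 𝓝 y, HasFDerivAt e (innerSL ℝ (G x)) x) (hG : HasFDerivAt G L y) :
    Exp2 e y (G y) L := by
  intro ε hε
  have h1 : ∀ᶠ x in 𝓝 y, ‖G x - G y - L (x - y)‖ ≤ ε * ‖x - y‖ :=
    (hG.isLittleO.def hε)
  obtain ⟨r, hr, hball⟩ := Metric.eventually_nhds_iff_ball.1 (he.and h1)
  filter_upwards [Metric.ball_mem_nhds (0 : V) hr] with k hk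
  have hk' : ‖k‖ < r := by simpa using hk
  set R : ℝ → ℝ := fun t => e (y + t • k) - e y - inner ℝ (G y) (t • k) - 1 / 2 * (t ^ 2 * inner ℝ (L k) k)
  have hmem : ∀ t ∈ Icc (0 : ℝ) 1, y + t • k ∈ ball y r := by
    intro t ht
    rw [mem_ball_iff_norm, add_sub_cancel_left, norm_smul, Real.norm_eq_abs, abs_of_nonneg ht.1]
    nlinarith [norm_nonneg k, ht.2]
  have hder : ∀ t ∈ Icc (0 : ℝ) 1, HasDerivWithinAt R
      (inner ℝ (G (y + t • k)) k - inner ℝ (G y) k - 1 / 2 * (2 * t * inner ℝ (L k) k)) (Icc 0 1) t := by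
    intro t ht
    apply HasDerivAt.hasDerivWithinAt
    have h2 := (hball _ (hmem t ht)).1
    have hl : HasDerivAt (fun t : ℝ => y + t • k) k t := by
      simpa using ((hasDerivAt_id t).smul_const k).const_add y
    have h3 := h2.comp_hasDerivAt t hl
    have h4 : HasDerivAt (fun t : ℝ => inner ℝ (G y) (t • k)) (inner ℝ (G y) k) t := by
      simp only [inner_smul_right]
      simpa using (hasDerivAt_id t).mul_const (inner ℝ (G y) k)
    have h5 : HasDerivAt (fun t : ℝ => 1 / 2 * (t ^ 2 * inner ℝ (L k) k))
        (1 / 2 * (2 * t * inner ℝ (L k) k)) t := by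
      have := ((hasDerivAt_pow 2 t).mul_const (inner ℝ (L k) k)).const_mul (1 / 2 : ℝ)
      simpa using this
    exact ((h3.sub_const (e y)).sub h4).sub h5
  have hbd : ∀ t ∈ Ico (0 : ℝ) 1,
      ‖inner ℝ (G (y + t • k)) k - inner ℝ (G y) k - 1 / 2 * (2 * t * inner ℝ (L k) k)‖
        ≤ ε * ‖k‖ ^ 2 := by
    intro t ht
    have h2 := (hball _ (hmem t ⟨ht.1, ht.2.le⟩)).2
    rw [add_sub_cancel_left] at h2
    have e1 : inner ℝ (G (y + t • k)) k - inner ℝ (G y) k - 1 / 2 * (2 * t * inner ℝ (L k) k)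
        = inner ℝ (G (y + t • k) - G y - L (t • k)) k := by
      rw [inner_sub_left, inner_sub_left, map_smul, inner_smul_left]
      simp; ring
    rw [e1]
    refine (norm_inner_le_norm _ _).trans ?_
    rw [norm_smul, Real.norm_eq_abs, abs_of_nonneg ht.1] at h2
    have h6 : t * ‖k‖ ≤ ‖k‖ := by nlinarith [norm_nonneg k, ht.2]
    have : ‖G (y + t • k) - G y - L (t • k)‖ ≤ ε * ‖k‖ := h2.trans (by gcongr)
    calc _ ≤ (ε * ‖k‖) * ‖k‖ := by gcongr
      _ = _ := by ring
  have := norm_image_sub_le_of_norm_deriv_le_segment_01' hder hbd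
  simpa [R] using this

/-- Alexandrov at a point where the proximal map is differentiable and `g` is touched from above. -/
lemma alexandrov_at {g : V → ℝ} (hg : ∀ z, ∃ ζ, SubG g z ζ) {J : V → V}
    (hJ : ∀ y, SubG g (J y) (y - J y)) {y G z : V} {c : ℝ} (hc : 0 ≤ c)
    (hz : J y = z) (hG : y = z + G)
    (htouch : ∀ᶠ h in 𝓝 (0 : V), g (z + h) ≤ g z + inner ℝ G h + c * ‖h‖ ^ 2)
    (hd : DifferentiableAt ℝ J y) : ∃ T, Exp2 g z G T := by
  have hGsub : SubG g z G := by
    have := hJ y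
    rw [hz, hG, add_sub_cancel_left] at this
    exact this
  -- Lipschitz type bound for subgradients near `z`
  obtain ⟨r, hr, hball⟩ := Metric.eventually_nhds_iff_ball.1 htouch
  have hlip : ∀ h : V, ‖h‖ < r / 2 → ∀ ζ', SubG g (z + h) ζ' → ‖ζ' - G‖ ≤ 4 * c * ‖h‖ := by
    intro h hh ζ' hζ'
    rcases eq_or_ne h 0 with rfl | hne
    · -- `h = 0`
      simp only [norm_zero, mul_zero, norm_le_zero_iff, sub_eq_zero]
      rw [add_zero] at hζ'
      by_contra hne
      have hpos : 0 < ‖ζ' - G‖ := norm_pos_iff.2 (sub_ne_zero.2 hne)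
      have hev : ∀ᶠ t in 𝓝[>] (0 : ℝ), ‖ζ' - G‖ ^ 2 ≤ t * (c * ‖ζ' - G‖ ^ 2) := by
        have : Tendsto (fun t : ℝ => t • (ζ' - G)) (𝓝[>] 0) (𝓝 0) := by
          have : Continuous (fun t : ℝ => t • (ζ' - G)) := by fun_prop
          have := this.tendsto 0
          rw [zero_smul] at this
          exact this.mono_left nhdsWithin_le_nhds
        filter_upwards [this.eventually htouch, self_mem_nhdsWithin] with t ht htpos
        have h1 := hζ' (z + t • (ζ' - G))
        have htpos : 0 < t := htpos
        rw [add_sub_cancel_left] at h1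
        have h2 : inner ℝ (ζ' - G) (t • (ζ' - G)) ≤ c * ‖t • (ζ' - G)‖ ^ 2 := by
          rw [inner_sub_left]; linarith
        rw [inner_smul_right, real_inner_self_eq_norm_sq, norm_smul, mul_pow, Real.norm_eq_abs,
          sq_abs] at h2
        have : t * ‖ζ' - G‖ ^ 2 ≤ t * (t * (c * ‖ζ' - G‖ ^ 2)) := by linarith
        exact le_of_mul_le_mul_left this htpos
      have hlim : Tendsto (fun t : ℝ => t * (c * ‖ζ' - G‖ ^ 2)) (𝓝[>] 0) (𝓝 0) := by
        have : Continuous (fun t : ℝ => t * (c * ‖ζ' - G‖ ^ 2)) := by fun_prop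
        have := this.tendsto 0
        rw [zero_mul] at this
        exact this.mono_left nhdsWithin_le_nhds
      have := ge_of_tendsto hlim hev
      nlinarith
    · have hhpos : 0 < ‖h‖ := norm_pos_iff.2 hne
      rcases eq_or_ne ζ' G with rfl | hne'
      · simp; positivity
      have hpos : 0 < ‖ζ' - G‖ := norm_pos_iff.2 (sub_ne_zero.2 hne')
      set v := (‖h‖ / ‖ζ' - G‖) • (ζ' - G) with hv
      have hvn : ‖v‖ = ‖h‖ := by
        rw [hv, norm_smul, Real.norm_eq_abs, abs_of_nonneg (by positivity)]
        field_simp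
      have hs : ‖h + v‖ ≤ 2 * ‖h‖ := by
        have := norm_add_le h v
        linarith
      have h1 := hball (h + v) (by simp; linarith)
      have h2 := hζ' (z + (h + v))
      have h3 := hGsub (z + h)
      rw [add_sub_cancel_left] at h3
      have e1 : z + (h + v) - (z + h) = v := by abel
      rw [e1] at h2
      rw [inner_add_right] at h1
      have h4 : inner ℝ (ζ' - G) v ≤ c * ‖h + v‖ ^ 2 := by
        rw [inner_sub_left]; linarith
      have h5 : inner ℝ (ζ' - G) v = ‖h‖ * ‖ζ' - G‖ := by
        rw [hv, inner_smul_right, real_inner_self_eq_norm_sq]; field_simp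
      have h6 : c * ‖h + v‖ ^ 2 ≤ c * (2 * ‖h‖) ^ 2 := by gcongr
      have : ‖h‖ * ‖ζ' - G‖ ≤ ‖h‖ * (4 * c * ‖h‖) := by rw [← h5]; linarith
      exact le_of_mul_le_mul_left this hhpos
  -- uniqueness of the proximal point
  have huniq : ∀ z' ζ', SubG g z' ζ' → J (z' + ζ') = z' := by
    intro z' ζ' h
    have h1 : SubG g z' (z' + ζ' - z') := by rwa [add_sub_cancel_left]
    have := (hJ (z' + ζ')).nonexp' h1
    simpa [sub_eq_zero] using this
  have hJlip : ∀ a b, ‖J a - J b‖ ≤ ‖a - b‖ := fun a b => (hJ a).nonexp' (hJ b)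
  set e : V → ℝ := fun y => g (J y) + 1 / 2 * ‖J y - y‖ ^ 2 with he
  have hele : ∀ y z', e y ≤ g z' + 1 / 2 * ‖z' - y‖ ^ 2 := by
    intro y z'
    have h1 := hJ y z'
    have e1 : z' - y = (J y - y) + (z' - J y) := by abel
    have e2 : inner ℝ (y - J y) (z' - J y) = - inner ℝ (J y - y) (z' - J y) := by
      rw [← inner_neg_left, neg_sub]
    rw [e1, norm_add_sq_real]
    simp only [he]
    have := sq_nonneg ‖z' - J y‖
    linarith
  have heup : ∀ a b, e b - e a - inner ℝ (a - J a) (b - a) ≤ 1 / 2 * ‖b - a‖ ^ 2 := by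
    intro a b
    have h1 := hele b (J a)
    have e1 : J a - b = (J a - a) - (b - a) := by abel
    have e2 : inner ℝ (a - J a) (b - a) = - inner ℝ (J a - a) (b - a) := by
      rw [← inner_neg_left, neg_sub]
    rw [e1, norm_sub_sq_real] at h1
    rw [e2]
    simp only [he] at h1 ⊢
    linarith
  have hgrad : ∀ a, HasFDerivAt e (innerSL ℝ (a - J a)) a := by
    intro a
    apply HasFDerivAt.of_isLittleO
    have hO : (fun b => e b - e a - (innerSL ℝ (a - J a)) (b - a)) =O[𝓝 a] fun b => ‖b - a‖ ^ 2 := by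
      apply Asymptotics.IsBigO.of_bound (1 / 2)
      filter_upwards with b
      rw [innerSL_apply_apply, Real.norm_eq_abs, Real.norm_eq_abs, abs_of_nonneg (sq_nonneg ‖b - a‖), abs_le]
      refine ⟨?_, heup a b⟩
      have h1 := heup b a
      have h2 : inner ℝ (b - J b) (a - b) = - inner ℝ (b - J b) (b - a) := by
        rw [← inner_neg_right, neg_sub]
      have h3 : inner ℝ (b - J b) (b - a) = inner ℝ (a - J a) (b - a) + ‖b - a‖ ^ 2
          - inner ℝ (J b - J a) (b - a) := by
        rw [← real_inner_self_eq_norm_sq (b - a), ← inner_add_left, ← inner_sub_left]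
        congr 1; abel
      have h4 : inner ℝ (J b - J a) (b - a) ≤ ‖b - a‖ ^ 2 := by
        have := real_inner_le_norm (J b - J a) (b - a)
        have := hJlip b a
        nlinarith [norm_nonneg (b - a)]
      rw [norm_sub_rev a b] at h1
      linarith
    refine hO.trans_isLittleO ?_
    have := Asymptotics.isLittleO_pow_sub_sub a (one_lt_two)
    simpa using this
  obtain ⟨D, hD⟩ := hd
  have hT2 : Exp2 e y (y - J y) (ContinuousLinearMap.id ℝ V - D) :=
    taylor2 (G := fun a => a - J a) (Eventually.of_forall hgrad) ((hasFDerivAt_id y).sub hD)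
  have hyG : y - J y = G := by rw [hz, hG]; abel
  -- injectivity of `D`
  have hDinj : Function.Injective D := by
    rw [injective_iff_map_eq_zero]
    intro k hk
    by_contra hne
    have hkpos : 0 < ‖k‖ := norm_pos_iff.2 hne
    have hcp : 0 < 1 + 4 * c := by linarith
    have h1 : ∀ᶠ x in 𝓝 y, ‖J x - J y - D (x - y)‖ ≤ (1 / (2 * (1 + 4 * c))) * ‖x - y‖ :=
      hD.isLittleO.def (by positivity)
    have hlim : Tendsto (fun t : ℝ => y + t • k) (𝓝[>] 0) (𝓝 y) := by
      have : Continuous (fun t : ℝ => y + t • k) := by fun_prop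
      have := this.tendsto 0
      rw [zero_smul, add_zero] at this
      exact this.mono_left nhdsWithin_le_nhds
    have h2 : ∀ᶠ x in 𝓝 y, x ∈ ball y (r / 2) := ball_mem_nhds _ (by positivity)
    obtain ⟨t, ⟨ht1, ht2⟩, ht3⟩ := ((hlim.eventually (h1.and h2)).and self_mem_nhdsWithin).exists
    have ht3 : 0 < t := ht3
    rw [add_sub_cancel_left, map_smul, hk, smul_zero, sub_zero] at ht1
    rw [mem_ball_iff_norm] at ht2
    set x := y + t • k with hx
    have hJx : ‖J x - J y‖ < r / 2 := (hJlip x y).trans_lt ht2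
    have h3 := hlip (J x - z) (by rw [← hz]; exact hJx) (x - J x) (by
      have := hJ x
      rwa [add_sub_cancel])
    have h4 : x - J x - G = t • k - (J x - J y) := by rw [← hyG, hx]; abel
    rw [h4, ← hz] at h3
    have h5 : ‖t • k‖ ≤ ‖t • k - (J x - J y)‖ + ‖J x - J y‖ := by
      simpa using norm_add_le (t • k - (J x - J y)) (J x - J y)
    have h6 : 0 < ‖t • k‖ := by rw [norm_smul]; have : 0 < ‖t‖ := norm_pos_iff.2 ht3.ne'; positivity
    have h7 : (1 + 4 * c) * ‖J x - J y‖ ≤ (1 + 4 * c) * (1 / (2 * (1 + 4 * c)) * ‖t • k‖) := by gcongr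
    have h8 : (1 + 4 * c) * (1 / (2 * (1 + 4 * c)) * ‖t • k‖) = ‖t • k‖ / 2 := by field_simp
    linarith
  obtain ⟨D', hD'⟩ : ∃ D' : V →L[ℝ] V, ∀ k, D' (D k) = k := by
    obtain ⟨F, hF⟩ := LinearMap.exists_leftInverse_of_injective (D : V →ₗ[ℝ] V)
      (LinearMap.ker_eq_bot.2 hDinj)
    exact ⟨LinearMap.toContinuousLinearMap F, fun k => LinearMap.congr_fun hF k⟩
  refine ⟨D' - ContinuousLinearMap.id ℝ V, ?_⟩
  intro ε hε
  set c1 := 1 + 4 * c with hc1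
  have hc1pos : 0 < c1 := by linarith
  obtain ⟨ε1, hε1, hε1'⟩ : ∃ ε1 > 0, ε1 * (‖D'‖ * c1 + 2 * c1 ^ 2) ≤ ε := by
    refine ⟨ε / (‖D'‖ * c1 + 2 * c1 ^ 2), by positivity, ?_⟩
    have : 0 < ‖D'‖ * c1 + 2 * c1 ^ 2 := by positivity
    rw [div_mul_cancel₀ _ this.ne']
  have hA : ∀ᶠ k in 𝓝 (0 : V), ‖J (y + k) - J y - D k‖ ≤ ε1 * ‖k‖ := by
    have h1 : ∀ᶠ x in 𝓝 y, ‖J x - J y - D (x - y)‖ ≤ ε1 * ‖x - y‖ := hD.isLittleO.def hε1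
    have hlim : Tendsto (fun k : V => y + k) (𝓝 0) (𝓝 y) := by
      have : Continuous (fun k : V => y + k) := by fun_prop
      simpa using this.tendsto 0
    filter_upwards [hlim.eventually h1] with k hk
    simpa using hk
  obtain ⟨r2, hr2, hball2⟩ := Metric.eventually_nhds_iff_ball.1 (hA.and (hT2 ε1 hε1))
  have hrad : 0 < min (r / 2) (r2 / c1) := by positivity
  filter_upwards [Metric.ball_mem_nhds (0 : V) hrad] with h hh
  have hh' : ‖h‖ < min (r / 2) (r2 / c1) := by simpa using hh
  obtain ⟨ζ', hζ'⟩ := hg (z + h)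
  have hζb := hlip h (hh'.trans_le (min_le_left _ _)) ζ' hζ'
  set k := h + (ζ' - G) with hk
  have hkb : ‖k‖ ≤ c1 * ‖h‖ := by
    have := norm_add_le h (ζ' - G)
    rw [← hk] at this
    rw [hc1]; linarith
  have hkr : k ∈ ball (0 : V) r2 := by
    have : ‖h‖ < r2 / c1 := hh'.trans_le (min_le_right _ _)
    rw [lt_div_iff₀ hc1pos] at this
    simp; linarith
  obtain ⟨hB1, hB2⟩ := hball2 k hkr
  have hyk : y + k = z + h + ζ' := by rw [hk, hG]; abel
  have hJk : J (y + k) = z + h := by rw [hyk]; exact huniq _ _ hζ'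
  rw [hJk, hz, add_sub_cancel_left] at hB1
  set ρ := h - D k with hρ
  have hDk : D k = h - ρ := by rw [hρ]; abel
  have hkD : k = D' h - D' ρ := by rw [← map_sub, ← hDk, hD']
  have he1 : e (y + k) = g (z + h) + 1 / 2 * ‖(h - k) - G‖ ^ 2 := by
    simp only [he]
    rw [hJk]
    congr 3
    rw [hG]; abel_nf
  have he2 : e y = g z + 1 / 2 * ‖G‖ ^ 2 := by
    simp only [he]
    rw [hz, ← norm_neg G]
    congr 3
    rw [hG]; congr 1; abel
  rw [he1, he2, hyG, norm_sub_sq_real] at hB2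
  simp only [sub_apply, ContinuousLinearMap.id_apply] at hB2 ⊢
  rw [hDk] at hB2
  have hI1 : |inner ℝ (D' ρ) h| ≤ ‖D'‖ * ε1 * c1 * ‖h‖ ^ 2 := by
    calc _ ≤ ‖D' ρ‖ * ‖h‖ := abs_real_inner_le_norm _ _
      _ ≤ (‖D'‖ * (ε1 * (c1 * ‖h‖))) * ‖h‖ := by
        gcongr
        refine (D'.le_opNorm ρ).trans ?_
        gcongr
        exact hB1.trans (by gcongr)
      _ = _ := by ring
  have hI2 : |inner ℝ ρ k| ≤ ε1 * c1 ^ 2 * ‖h‖ ^ 2 := by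
    calc _ ≤ ‖ρ‖ * ‖k‖ := abs_real_inner_le_norm _ _
      _ ≤ (ε1 * (c1 * ‖h‖)) * (c1 * ‖h‖) := by
        gcongr
        exact hB1.trans (by gcongr)
      _ = _ := by ring
  have hk2 : ε1 * ‖k‖ ^ 2 ≤ ε1 * c1 ^ 2 * ‖h‖ ^ 2 := by
    calc _ ≤ ε1 * (c1 * ‖h‖) ^ 2 := by gcongr
      _ = _ := by ring
  have hfin : g (z + h) - g z - inner ℝ G h - 1 / 2 * inner ℝ (D' h - h) h
      = (g (z + h) + 1 / 2 * (‖h - k‖ ^ 2 - 2 * inner ℝ (h - k) G + ‖G‖ ^ 2)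
          - (g z + 1 / 2 * ‖G‖ ^ 2) - inner ℝ G k - 1 / 2 * inner ℝ (k - (h - ρ)) k)
        - 1 / 2 * inner ℝ (D' ρ) h + 1 / 2 * inner ℝ ρ k := by
    have e1 : D' h = k + D' ρ := by rw [eq_sub_iff_add_eq.1 hkD]
    rw [e1, norm_sub_sq_real]
    simp only [inner_sub_left, inner_add_left, real_inner_self_eq_norm_sq]
    rw [real_inner_comm h G, real_inner_comm k G, real_inner_comm h k]
    ring
  rw [hfin]
  have hεh : ε1 * (‖D'‖ * c1 + 2 * c1 ^ 2) * ‖h‖ ^ 2 ≤ ε * ‖h‖ ^ 2 := by gcongr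
  have hnn : 0 ≤ ‖D'‖ * ε1 * c1 * ‖h‖ ^ 2 := by positivity
  have hnn2 : 0 ≤ ε1 * c1 ^ 2 * ‖h‖ ^ 2 := by positivity
  rw [abs_le] at *
  constructor <;> linarith [hI1.1, hI1.2, hI2.1, hI2.2, hB2.1, hB2.2]

end JensenAlexandrov

section Jensen

variable {V : Type*} [NormedAddCommGroup V] [InnerProductSpace ℝ V] [FiniteDimensional ℝ V]

lemma jensen_alexandrov {w : V → ℝ} {C : ℝ} (hC : 0 ≤ C)
    (hw : ∀ z, ∃ ζ, ∀ z', w z + inner ℝ ζ (z' - z) - C * ‖z' - z‖ ^ 2 ≤ w z')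
    {s : ℝ} (hs : 0 < s) {m : ℝ} (hm : ∀ z, ‖z‖ = s → w z ≤ m) (hm0 : m < w 0)
    {δ : ℝ} (hδ : 0 < δ) :
    ∃ (q z : V) (T : V →L[ℝ] V), ‖q‖ < δ ∧ ‖z‖ < s ∧ w 0 + inner ℝ q z ≤ w z ∧
      (∀ᶠ h in 𝓝 (0 : V), w (z + h) ≤ w z + inner ℝ q h) ∧ Exp2 w z q T := by
  let _ : MeasurableSpace V := borel V
  have _ : BorelSpace V := ⟨rfl⟩
  set g : V → ℝ := fun z => w z + C * ‖z‖ ^ 2 with hgdef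
  have hexp : ∀ z h : V, ‖z + h‖ ^ 2 = ‖z‖ ^ 2 + 2 * inner ℝ z h + ‖h‖ ^ 2 :=
    fun z h => norm_add_sq_real z h
  have hsubg : ∀ z ζ, (∀ z', w z + inner ℝ ζ (z' - z) - C * ‖z' - z‖ ^ 2 ≤ w z') →
      SubG g z (ζ + (2 * C) • z) := by
    intro z ζ h z'
    have h1 := h z'
    have h2 := hexp z (z' - z)
    rw [add_sub_cancel] at h2
    simp only [hgdef]
    rw [h2, inner_add_left, inner_smul_left]
    simp only [conj_trivial]
    nlinarith
  have hg : ∀ z, ∃ ζ, SubG g z ζ := fun z => by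
    obtain ⟨ζ, h⟩ := hw z
    exact ⟨_, hsubg z ζ h⟩
  choose J hJ using exists_prox hg
  have hJlip : ∀ a b, ‖J a - J b‖ ≤ ‖a - b‖ := fun a b => (hJ a).nonexp' (hJ b)
  have hJL : LipschitzWith 1 J := LipschitzWith.of_dist_le_mul (fun a b => by
    simpa [dist_eq_norm] using hJlip a b)
  have hgc : Continuous g := continuous_of_subG hg
  have hwc : Continuous w := by
    have : w = fun z => g z - C * ‖z‖ ^ 2 := by funext z; simp [hgdef]
    rw [this]; fun_prop
  set P : V → V := fun y => y - (1 + 2 * C) • J y with hP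
  have hPL : LipschitzWith (Real.toNNReal (2 + 2 * C)) P := by
    apply LipschitzWith.of_dist_le_mul
    intro a b
    rw [dist_eq_norm, dist_eq_norm, Real.coe_toNNReal _ (by linarith)]
    have e : P a - P b = (a - b) - (1 + 2 * C) • (J a - J b) := by
      simp only [hP, smul_sub]; abel
    rw [e]
    refine (norm_sub_le _ _).trans ?_
    rw [norm_smul, Real.norm_eq_abs, abs_of_nonneg (by linarith)]
    nlinarith [hJlip a b]
  set μ : Measure V := Measure.hausdorffMeasure (Module.finrank ℝ V) with hμ
  have hnull : μ {y | ¬ DifferentiableAt ℝ J y} = 0 := hJL.ae_differentiableAt (μ := μ)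
  have hPnull : μ (P '' {y | ¬ DifferentiableAt ℝ J y}) = 0 := by
    have := hPL.hausdorffMeasure_image_le (d := Module.finrank ℝ V) (by positivity)
      {y | ¬ DifferentiableAt ℝ J y}
    rw [← hμ, hnull, mul_zero] at this
    exact le_antisymm this (by simp)
  set δ' := min δ ((w 0 - m) / (2 * s)) with hδ'
  have hδ'pos : 0 < δ' := by
    apply lt_min hδ
    apply div_pos <;> linarith
  obtain ⟨q, hqb, hq⟩ : ∃ q ∈ ball (0 : V) δ', q ∉ P '' {y | ¬ DifferentiableAt ℝ J y} := by
    by_contra hcon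
    push Not at hcon
    have h1 : μ (ball (0 : V) δ') ≤ 0 := by
      rw [← hPnull]; exact measure_mono hcon
    have h2 := Metric.measure_ball_pos μ (0 : V) hδ'pos
    exact absurd h1 (not_le.2 h2)
  have hqn : ‖q‖ < δ' := by simpa using hqb
  obtain ⟨z, hz, hzmax⟩ := (isCompact_closedBall (0 : V) s).exists_isMaxOn
    ⟨0, by simp [hs.le]⟩ (f := fun z => w z - inner ℝ q z) (by fun_prop)
  have hz0 : w 0 + inner ℝ q z ≤ w z := by
    have : w 0 - inner ℝ q 0 ≤ w z - inner ℝ q z := hzmax (show (0 : V) ∈ closedBall 0 s by simp [hs.le])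
    rw [inner_zero_right] at this; linarith
  have hzs : ‖z‖ < s := by
    have h1 : ‖z‖ ≤ s := by simpa using hz
    refine lt_of_le_of_ne h1 (fun h => ?_)
    have h2 := hm z h
    have h3 := abs_le.1 (abs_real_inner_le_norm q z)
    rw [h] at h3
    have h4 : ‖q‖ * s < (w 0 - m) := by
      have : ‖q‖ < (w 0 - m) / (2 * s) := hqn.trans_le (min_le_right _ _)
      rw [lt_div_iff₀ (by positivity)] at this
      nlinarith [norm_nonneg q]
    linarith [h3.1]
  have hloc : ∀ᶠ h in 𝓝 (0 : V), w (z + h) ≤ w z + inner ℝ q h := by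
    filter_upwards [Metric.ball_mem_nhds (0 : V) (sub_pos.2 hzs)] with h hh
    have hh' : ‖h‖ < s - ‖z‖ := by simpa using hh
    have : w (z + h) - inner ℝ q (z + h) ≤ w z - inner ℝ q z := hzmax (show z + h ∈ closedBall 0 s by
      have := norm_add_le z h
      simp; linarith)
    rw [inner_add_right] at this; linarith
  have htouch : ∀ᶠ h in 𝓝 (0 : V),
      g (z + h) ≤ g z + inner ℝ (q + (2 * C) • z) h + C * ‖h‖ ^ 2 := by
    filter_upwards [hloc] with h hh
    simp only [hgdef]
    rw [hexp, inner_add_left, inner_smul_left]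
    simp only [conj_trivial]
    nlinarith
  have hζq : ∃ ζ, ζ = q ∧ ∀ z', w z + inner ℝ ζ (z' - z) - C * ‖z' - z‖ ^ 2 ≤ w z' := by
    obtain ⟨ζ, hζ⟩ := hw z
    refine ⟨ζ, ?_, hζ⟩
    by_contra hne
    have hpos : 0 < ‖ζ - q‖ := norm_pos_iff.2 (sub_ne_zero.2 hne)
    have hlim0 : Tendsto (fun t : ℝ => t • (ζ - q)) (𝓝[>] 0) (𝓝 0) := by
      have : Continuous (fun t : ℝ => t • (ζ - q)) := by fun_prop
      have := this.tendsto 0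
      rw [zero_smul] at this
      exact this.mono_left nhdsWithin_le_nhds
    have hev : ∀ᶠ t in 𝓝[>] (0 : ℝ), ‖ζ - q‖ ^ 2 ≤ t * (C * ‖ζ - q‖ ^ 2) := by
      filter_upwards [hlim0.eventually hloc, self_mem_nhdsWithin] with t ht htpos
      have h1 := hζ (z + t • (ζ - q))
      have htpos : 0 < t := htpos
      rw [add_sub_cancel_left] at h1
      have h2 : inner ℝ (ζ - q) (t • (ζ - q)) ≤ C * ‖t • (ζ - q)‖ ^ 2 := by
        rw [inner_sub_left]; linarith
      rw [inner_smul_right, real_inner_self_eq_norm_sq, norm_smul, mul_pow, Real.norm_eq_abs,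
        sq_abs] at h2
      have : t * ‖ζ - q‖ ^ 2 ≤ t * (t * (C * ‖ζ - q‖ ^ 2)) := by linarith
      exact le_of_mul_le_mul_left this htpos
    have hlim : Tendsto (fun t : ℝ => t * (C * ‖ζ - q‖ ^ 2)) (𝓝[>] 0) (𝓝 0) := by
      have : Continuous (fun t : ℝ => t * (C * ‖ζ - q‖ ^ 2)) := by fun_prop
      have := this.tendsto 0
      rw [zero_mul] at this
      exact this.mono_left nhdsWithin_le_nhds
    have := ge_of_tendsto hlim hev
    nlinarith
  obtain ⟨ζ, rfl, hζ⟩ := hζq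
  have hGsub := hsubg z ζ hζ
  set G := ζ + (2 * C) • z with hG
  have hJy : J (z + G) = z := by
    have h1 : SubG g z (z + G - z) := by rwa [add_sub_cancel_left]
    have := (hJ (z + G)).nonexp' h1
    simpa [sub_eq_zero] using this
  have hdiff : DifferentiableAt ℝ J (z + G) := by
    by_contra hnd
    apply hq
    refine ⟨z + G, hnd, ?_⟩
    simp only [hP]
    rw [hJy, hG]; module
  obtain ⟨T, hT⟩ := alexandrov_at hg hJ hC hJy rfl htouch hdiff
  refine ⟨ζ, z, T - (2 * C) • ContinuousLinearMap.id ℝ V, hqn.trans_le (min_le_left _ _), hzs, hz0,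
    hloc, ?_⟩
  intro ε hε
  filter_upwards [hT ε hε] with h hh
  have e : w (z + h) - w z - inner ℝ ζ h
      - 1 / 2 * inner ℝ ((T - (2 * C) • ContinuousLinearMap.id ℝ V) h) h
      = g (z + h) - g z - inner ℝ G h - 1 / 2 * inner ℝ (T h) h := by
    simp only [hgdef]
    rw [hexp, hG, inner_add_left, inner_smul_left]
    simp only [sub_apply, smul_apply, ContinuousLinearMap.id_apply, inner_sub_left,
      inner_smul_left, conj_trivial, real_inner_self_eq_norm_sq]
    ring
  rw [e]; exact hh

end Jensen

section Sums

variable {E : Type*} [NormedAddCommGroup E] [InnerProductSpace ℝ E] [FiniteDimensional ℝ E]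

lemma exists_supconv {U : E → ℝ} {δ : ℝ} (hδ : 0 < δ) (hU : ContinuousOn U (closedBall 0 δ)) (n : ℝ) :
    ∃ X : E → E, (∀ x, X x ∈ closedBall (0 : E) δ) ∧
      ∀ x, ∀ ξ ∈ closedBall (0 : E) δ, U ξ - n * ‖x - ξ‖ ^ 2 ≤ U (X x) - n * ‖x - X x‖ ^ 2 := by
  have : ∀ x, ∃ y ∈ closedBall (0 : E) δ, ∀ ξ ∈ closedBall (0 : E) δ,
      U ξ - n * ‖x - ξ‖ ^ 2 ≤ U y - n * ‖x - y‖ ^ 2 := by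
    intro x
    obtain ⟨y, hy, hmax⟩ := (isCompact_closedBall (0 : E) δ).exists_isMaxOn ⟨0, by simp [hδ.le]⟩
      (f := fun ξ => U ξ - n * ‖x - ξ‖ ^ 2) (hU.sub (by fun_prop))
    exact ⟨y, hy, fun ξ hξ => hmax hξ⟩
  choose X hX hX' using this
  exact ⟨X, hX, hX'⟩

lemma prod_nsq (z : WithLp 2 (E × E)) : ‖z‖ ^ 2 = ‖z.fst‖ ^ 2 + ‖z.snd‖ ^ 2 :=
  WithLp.prod_norm_sq_eq_of_L2 z

lemma prod_fst_le (z : WithLp 2 (E × E)) : ‖z.fst‖ ≤ ‖z‖ := by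
  have := prod_nsq z
  refine (sq_le_sq₀ (norm_nonneg _) (norm_nonneg _)).1 ?_
  nlinarith [sq_nonneg ‖z.snd‖]

lemma prod_snd_le (z : WithLp 2 (E × E)) : ‖z.snd‖ ≤ ‖z‖ := by
  have := prod_nsq z
  refine (sq_le_sq₀ (norm_nonneg _) (norm_nonneg _)).1 ?_
  nlinarith [sq_nonneg ‖z.fst‖]

lemma prod_in (z h : WithLp 2 (E × E)) : inner ℝ z h = inner ℝ z.fst h.fst + inner ℝ z.snd h.snd :=
  WithLp.prod_inner_apply z h

set_option maxHeartbeats 2000000 in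
lemma theorem_on_sums {u₁ u₂ : E → ℝ} {a₁ a₂ q₁ q₂ : E} {δ₀ : ℝ} (hδ₀ : 0 < δ₀)
    (hc₁ : ContinuousOn u₁ (closedBall a₁ δ₀)) (hc₂ : ContinuousOn u₂ (closedBall a₂ δ₀))
    (S : E → (E →L[ℝ] E) → Prop)
    (hS₁ : ∀ x ∈ ball a₁ δ₀, ∀ q T, (∀ᶠ ξ in 𝓝 (0 : E),
      u₁ (x + ξ) ≤ u₁ x + inner ℝ q ξ + 1 / 2 * inner ℝ (T ξ) ξ) → S q T)
    (hS₂ : ∀ x ∈ ball a₂ δ₀, ∀ q T, (∀ᶠ ξ in 𝓝 (0 : E),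
      u₂ (x + ξ) ≤ u₂ x + inner ℝ q ξ + 1 / 2 * inner ℝ (T ξ) ξ) → S q T)
    (B : WithLp 2 (E × E) →L[ℝ] WithLp 2 (E × E)) (hB : ∀ z h, inner ℝ (B z) h = inner ℝ (B h) z)
    (hmax : ∀ z : WithLp 2 (E × E), z.fst ∈ closedBall (0 : E) δ₀ → z.snd ∈ closedBall (0 : E) δ₀ →
      u₁ (a₁ + z.fst) + u₂ (a₂ + z.snd) ≤ u₁ a₁ + u₂ a₂ + inner ℝ q₁ z.fst + inner ℝ q₂ z.snd
        + 1 / 2 * inner ℝ (B z) z)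
    {θ : ℝ} (hθ : 0 < θ) :
    ∃ (q₁' q₂' : E) (T₁ T₂ : E →L[ℝ] E), S q₁' T₁ ∧ S q₂' T₂ ∧ ‖q₁' - q₁‖ ≤ θ ∧ ‖q₂' - q₂‖ ≤ θ ∧
      ∀ z : WithLp 2 (E × E), inner ℝ (T₁ z.fst) z.fst + inner ℝ (T₂ z.snd) z.snd
        ≤ inner ℝ (B z) z + 8 * θ * ‖z‖ ^ 2 := by
  set b := ‖B‖ with hb
  have hb0 : 0 ≤ b := by rw [hb]; exact norm_nonneg B
  have hQadd : ∀ z h, inner ℝ (B (z + h)) (z + h)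
      = inner ℝ (B z) z + 2 * inner ℝ (B z) h + inner ℝ (B h) h := by
    intro z h
    rw [map_add, inner_add_left, inner_add_right, inner_add_right, hB h z]; ring
  have hQb : ∀ z h, |inner ℝ (B z) h| ≤ b * ‖z‖ * ‖h‖ := by
    intro z h
    refine (abs_real_inner_le_norm _ _).trans ?_
    gcongr
    exact B.le_opNorm z
  set U₁ : E → ℝ := fun ξ => u₁ (a₁ + ξ) - u₁ a₁ - inner ℝ q₁ ξ with hU₁
  set U₂ : E → ℝ := fun ξ => u₂ (a₂ + ξ) - u₂ a₂ - inner ℝ q₂ ξ with hU₂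
  have hUc₁ : ContinuousOn U₁ (closedBall 0 δ₀) := by
    refine ContinuousOn.sub (ContinuousOn.sub ?_ continuousOn_const) (by fun_prop)
    refine hc₁.comp (by fun_prop) (fun ξ hξ => ?_)
    simpa using hξ
  have hUc₂ : ContinuousOn U₂ (closedBall 0 δ₀) := by
    refine ContinuousOn.sub (ContinuousOn.sub ?_ continuousOn_const) (by fun_prop)
    refine hc₂.comp (by fun_prop) (fun ξ hξ => ?_)
    simpa using hξ
  set n : ℝ := b + b ^ 2 / θ + 1 with hn
  have hbt : 0 ≤ b ^ 2 / θ := by positivity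
  have hn1 : 1 ≤ n := by linarith
  have hnb : b ≤ n := by linarith
  have hnb2 : b ^ 2 ≤ n * θ := by
    rw [hn, add_mul, add_mul, div_mul_cancel₀ _ hθ.ne']; nlinarith
  obtain ⟨X₁, hX₁, hX₁'⟩ := exists_supconv hδ₀ hUc₁ n
  obtain ⟨X₂, hX₂, hX₂'⟩ := exists_supconv hδ₀ hUc₂ n
  set W₁ : E → ℝ := fun x => U₁ (X₁ x) - n * ‖x - X₁ x‖ ^ 2 with hW₁
  set W₂ : E → ℝ := fun x => U₂ (X₂ x) - n * ‖x - X₂ x‖ ^ 2 with hW₂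
  set W : WithLp 2 (E × E) → ℝ := fun z => W₁ z.fst + W₂ z.snd with hW
  set w : WithLp 2 (E × E) → ℝ := fun z => W z - 1 / 2 * inner ℝ (B z) z - θ * ‖z‖ ^ 2 with hw
  -- semiconvexity
  have hsc : ∀ (U : E → ℝ) (X : E → E), (∀ x, X x ∈ closedBall (0 : E) δ₀) →
      (∀ x, ∀ ξ ∈ closedBall (0 : E) δ₀, U ξ - n * ‖x - ξ‖ ^ 2 ≤ U (X x) - n * ‖x - X x‖ ^ 2) →
      ∀ x x', (U (X x) - n * ‖x - X x‖ ^ 2) + inner ℝ ((2 * n) • (X x - x)) (x' - x) - n * ‖x' - x‖ ^ 2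
        ≤ U (X x') - n * ‖x' - X x'‖ ^ 2 := by
    intro U X hX hX' x x'
    have h1 := hX' x' (X x) (hX x)
    have e1 : x' - X x = (x - X x) + (x' - x) := by abel
    have e2 : X x - x = -(x - X x) := by abel
    rw [e1, norm_add_sq_real] at h1
    rw [e2, smul_neg, inner_neg_left, inner_smul_left]
    simp only [conj_trivial]
    nlinarith
  have hwsc : ∀ z, ∃ ζ, ∀ z', w z + inner ℝ ζ (z' - z) - (n + b / 2 + θ) * ‖z' - z‖ ^ 2 ≤ w z' := by
    intro z
    refine ⟨WithLp.toLp 2 ((2 * n) • (X₁ z.fst - z.fst), (2 * n) • (X₂ z.snd - z.snd)) - B z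
      - (2 * θ) • z, fun z' => ?_⟩
    have h1 := hsc U₁ X₁ hX₁ hX₁' z.fst z'.fst
    have h2 := hsc U₂ X₂ hX₂ hX₂' z.snd z'.snd
    have h3 := hQadd z (z' - z)
    have h4 := norm_add_sq_real z (z' - z)
    rw [add_sub_cancel] at h3 h4
    have h5 := abs_le.1 (hQb (z' - z) (z' - z))
    have h6 := prod_nsq (z' - z)
    have h7 : inner ℝ (WithLp.toLp 2 ((2 * n) • (X₁ z.fst - z.fst), (2 * n) • (X₂ z.snd - z.snd)))
        (z' - z) = inner ℝ ((2 * n) • (X₁ z.fst - z.fst)) (z'.fst - z.fst)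
          + inner ℝ ((2 * n) • (X₂ z.snd - z.snd)) (z'.snd - z.snd) := by
      rw [WithLp.prod_inner_apply]; rfl
    simp only [hw, hW, hW₁, hW₂]
    rw [h3, h4, inner_sub_left, inner_sub_left, inner_smul_left, h7]
    simp only [conj_trivial, WithLp.sub_fst, WithLp.sub_snd] at h6 ⊢
    rw [h6]
    clear_value n
    rw [mul_assoc, ← sq, h6] at h5
    linarith [h5.1, h5.2]
  -- upper bound
  have hup : ∀ z : WithLp 2 (E × E), w z ≤ b * ‖z‖ * ‖(WithLp.toLp 2 (X₁ z.fst, X₂ z.snd) - z : WithLp 2 (E × E))‖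
      - n / 2 * ‖(WithLp.toLp 2 (X₁ z.fst, X₂ z.snd) - z : WithLp 2 (E × E))‖ ^ 2 - θ * ‖z‖ ^ 2 := by
    intro z
    set d : WithLp 2 (E × E) := WithLp.toLp 2 (X₁ z.fst, X₂ z.snd) - z with hd
    have hzd : z + d = WithLp.toLp 2 (X₁ z.fst, X₂ z.snd) := by rw [hd]; abel
    have h1 := hmax (z + d) (by rw [hzd]; exact hX₁ _) (by rw [hzd]; exact hX₂ _)
    rw [hQadd] at h1
    have h2 := abs_le.1 (hQb z d)
    have h3 := abs_le.1 (hQb d d)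
    have h6 := prod_nsq d
    have e1 : ‖d.fst‖ = ‖z.fst - X₁ z.fst‖ := by rw [hd, norm_sub_rev]; rfl
    have e2 : ‖d.snd‖ = ‖z.snd - X₂ z.snd‖ := by rw [hd, norm_sub_rev]; rfl
    rw [e1, e2] at h6
    have e3 : (z + d).fst = X₁ z.fst := by rw [hzd]; rfl
    have e4 : (z + d).snd = X₂ z.snd := by rw [hzd]; rfl
    rw [e3, e4] at h1
    simp only [hw, hW, hW₁, hW₂, hU₁, hU₂]
    have h7 : b * ‖d‖ * ‖d‖ ≤ n * ‖d‖ ^ 2 := by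
      rw [mul_assoc, ← sq]; gcongr
    have h8 : n * ‖d‖ ^ 2 = n * ‖z.fst - X₁ z.fst‖ ^ 2 + n * ‖z.snd - X₂ z.snd‖ ^ 2 := by
      rw [h6]; ring
    linarith [h2.2, h3.2]
  have hw0 : 0 ≤ w 0 := by
    have h1 := hX₁' 0 0 (by simp [hδ₀.le])
    have h2 := hX₂' 0 0 (by simp [hδ₀.le])
    simp only [hU₁, hU₂] at h1 h2
    simp only [hw, hW, hW₁, hW₂, hU₁, hU₂]
    simp at h1 h2 ⊢
    linarith
  -- choice of the radius
  obtain ⟨s, hs, hs1, hs2, hs3, hs4⟩ : ∃ s > 0, s ≤ δ₀ / 2 ∧ 2 * s * b ≤ δ₀ / 8 ∧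
      2 * s ≤ δ₀ ^ 2 / 16 ∧ s * (b + 2 * θ) ≤ θ / 2 := by
    refine ⟨min (min (δ₀ / 2) (δ₀ / (16 * (b + 1)))) (min (δ₀ ^ 2 / 32) (θ / (2 * (b + 2 * θ)))),
      by positivity, ?_, ?_, ?_, ?_⟩
    · exact (min_le_left _ _).trans (min_le_left _ _)
    · have h1 : min (min (δ₀ / 2) (δ₀ / (16 * (b + 1)))) (min (δ₀ ^ 2 / 32) (θ / (2 * (b + 2 * θ))))
        ≤ δ₀ / (16 * (b + 1)) := (min_le_left _ _).trans (min_le_right _ _)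
      rw [le_div_iff₀ (by positivity)] at h1
      have h0 : 0 < min (min (δ₀ / 2) (δ₀ / (16 * (b + 1)))) (min (δ₀ ^ 2 / 32) (θ / (2 * (b + 2 * θ)))) := by
        positivity
      nlinarith
    · have h1 : min (min (δ₀ / 2) (δ₀ / (16 * (b + 1)))) (min (δ₀ ^ 2 / 32) (θ / (2 * (b + 2 * θ))))
        ≤ δ₀ ^ 2 / 32 := (min_le_right _ _).trans (min_le_left _ _)
      linarith
    · have h1 : min (min (δ₀ / 2) (δ₀ / (16 * (b + 1)))) (min (δ₀ ^ 2 / 32) (θ / (2 * (b + 2 * θ))))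
        ≤ θ / (2 * (b + 2 * θ)) := (min_le_right _ _).trans (min_le_right _ _)
      rw [le_div_iff₀ (by positivity)] at h1
      linarith
  have hsphere : ∀ z : WithLp 2 (E × E), ‖z‖ = s → w z ≤ - (θ * s ^ 2 / 2) := by
    intro z hz
    have h1 := hup z
    set d : WithLp 2 (E × E) := WithLp.toLp 2 (X₁ z.fst, X₂ z.snd) - z
    rw [hz] at h1
    have h2 : 0 ≤ (n * ‖d‖ - b * s) ^ 2 := sq_nonneg _
    have h3 : b ^ 2 * s ^ 2 ≤ n * θ * s ^ 2 := by gcongr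
    have h4 : 0 ≤ n * (n * ‖d‖ ^ 2 - 2 * b * s * ‖d‖ + θ * s ^ 2) := by nlinarith
    have h5 := nonneg_of_mul_nonneg_right h4 (by linarith)
    linarith
  have hmneg : - (θ * s ^ 2 / 2) < w 0 := by
    have : 0 < θ * s ^ 2 / 2 := by positivity
    linarith
  obtain ⟨q, z, T, hq, hzs, hzw, hloc, hexp⟩ := jensen_alexandrov (by positivity) hwsc hs hsphere hmneg
    (lt_min one_pos (half_pos hθ))
  have hq1 : ‖q‖ ≤ 1 := (hq.trans_le (min_le_left _ _)).le
  have hq2 : ‖q‖ ≤ θ / 2 := (hq.trans_le (min_le_right _ _)).le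
  -- the maximum points are interior
  have hd : ‖(WithLp.toLp 2 (X₁ z.fst, X₂ z.snd) - z : WithLp 2 (E × E))‖ < δ₀ / 2 := by
    have h1 := hup z
    set d : WithLp 2 (E × E) := WithLp.toLp 2 (X₁ z.fst, X₂ z.snd) - z
    by_contra hcon
    push Not at hcon
    have h2 := (abs_le.1 (abs_real_inner_le_norm q z)).1
    have h3 : ‖q‖ * ‖z‖ ≤ 1 * s := by gcongr
    have h4 : b * ‖z‖ * ‖d‖ ≤ b * s * ‖d‖ := by gcongr
    have h5 : n / 2 * ‖d‖ ^ 2 ≥ 1 / 2 * ‖d‖ ^ 2 := by gcongr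
    have h6 : 0 ≤ θ * ‖z‖ ^ 2 := by positivity
    have h7 : 2 * s * b * ‖d‖ ≤ δ₀ / 8 * ‖d‖ := by gcongr
    have h8 : δ₀ / 2 * ‖d‖ ≤ ‖d‖ * ‖d‖ := by gcongr
    have h9 : δ₀ * (δ₀ / 2) ≤ δ₀ * ‖d‖ := by gcongr
    have h10 : 0 < δ₀ ^ 2 := by positivity
    clear_value d n
    linarith
  have hXi₁ : ‖X₁ z.fst‖ < δ₀ := by
    have h1 := prod_fst_le (WithLp.toLp 2 (X₁ z.fst, X₂ z.snd) - z : WithLp 2 (E × E))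
    have h2 := prod_fst_le z
    rw [WithLp.sub_fst] at h1
    have h3 : ‖X₁ z.fst‖ ≤ ‖X₁ z.fst - z.fst‖ + ‖z.fst‖ := by
      simpa using norm_add_le (X₁ z.fst - z.fst) z.fst
    change ‖X₁ z.fst - z.fst‖ ≤ _ at h1
    linarith
  have hXi₂ : ‖X₂ z.snd‖ < δ₀ := by
    have h1 := prod_snd_le (WithLp.toLp 2 (X₁ z.fst, X₂ z.snd) - z : WithLp 2 (E × E))
    have h2 := prod_snd_le z
    rw [WithLp.sub_snd] at h1
    have h3 : ‖X₂ z.snd‖ ≤ ‖X₂ z.snd - z.snd‖ + ‖z.snd‖ := by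
      simpa using norm_add_le (X₂ z.snd - z.snd) z.snd
    change ‖X₂ z.snd - z.snd‖ ≤ _ at h1
    linarith
  set G : WithLp 2 (E × E) := q + B z + (2 * θ) • z with hG
  set T' : WithLp 2 (E × E) →L[ℝ] WithLp 2 (E × E) :=
    T + B + (2 * θ) • ContinuousLinearMap.id ℝ _ with hT'
  have hWexp : ∀ h, W (z + h) - W z - inner ℝ G h = w (z + h) - w z - inner ℝ q h
      + 1 / 2 * inner ℝ (B h) h + θ * ‖h‖ ^ 2 := by
    intro h
    simp only [hw]
    rw [hQadd, norm_add_sq_real, hG, inner_add_left, inner_add_left, inner_smul_left]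
    simp only [conj_trivial]
    ring
  have hE : ∀ᶠ h in 𝓝 (0 : WithLp 2 (E × E)),
      |W (z + h) - W z - inner ℝ G h - 1 / 2 * inner ℝ (T' h) h| ≤ θ * ‖h‖ ^ 2 := by
    filter_upwards [hexp θ hθ] with h hh
    have e : W (z + h) - W z - inner ℝ G h - 1 / 2 * inner ℝ (T' h) h
        = w (z + h) - w z - inner ℝ q h - 1 / 2 * inner ℝ (T h) h := by
      rw [hWexp, hT']
      simp only [add_apply, smul_apply, ContinuousLinearMap.id_apply, inner_add_left,
        inner_smul_left, conj_trivial, real_inner_self_eq_norm_sq]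
      ring
    rw [e]; exact hh
  have hGn : ‖G‖ ≤ θ := by
    have h1 : ‖G‖ ≤ ‖q‖ + b * ‖z‖ + 2 * θ * ‖z‖ := by
      refine (norm_add₃_le).trans ?_
      rw [norm_smul, Real.norm_eq_abs, abs_of_nonneg (by positivity)]
      gcongr
      exact B.le_opNorm z
    have h2 : (b + 2 * θ) * ‖z‖ ≤ (b + 2 * θ) * s := by gcongr
    linarith
  -- embeddings
  set i₁ : E →L[ℝ] WithLp 2 (E × E) := ((WithLp.prodContinuousLinearEquiv 2 ℝ E E).symm :
    E × E →L[ℝ] WithLp 2 (E × E)).comp (ContinuousLinearMap.inl ℝ E E) with hi₁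
  set i₂ : E →L[ℝ] WithLp 2 (E × E) := ((WithLp.prodContinuousLinearEquiv 2 ℝ E E).symm :
    E × E →L[ℝ] WithLp 2 (E × E)).comp (ContinuousLinearMap.inr ℝ E E) with hi₂
  set p₁ : WithLp 2 (E × E) →L[ℝ] E := (ContinuousLinearMap.fst ℝ E E).comp
    (WithLp.prodContinuousLinearEquiv 2 ℝ E E : WithLp 2 (E × E) →L[ℝ] E × E) with hp₁
  set p₂ : WithLp 2 (E × E) →L[ℝ] E := (ContinuousLinearMap.snd ℝ E E).comp
    (WithLp.prodContinuousLinearEquiv 2 ℝ E E : WithLp 2 (E × E) →L[ℝ] E × E) with hp₂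
  have i₁f : ∀ ξ, (i₁ ξ).fst = ξ := fun ξ => rfl
  have i₁s : ∀ ξ, (i₁ ξ).snd = 0 := fun ξ => rfl
  have i₂f : ∀ ξ, (i₂ ξ).fst = 0 := fun ξ => rfl
  have i₂s : ∀ ξ, (i₂ ξ).snd = ξ := fun ξ => rfl
  have p₁f : ∀ z, p₁ z = z.fst := fun ξ => rfl
  have p₂s : ∀ z, p₂ z = z.snd := fun ξ => rfl
  have in₁ : ∀ v ξ, inner ℝ v (i₁ ξ) = inner ℝ v.fst ξ := by
    intro v ξ; rw [prod_in, i₁f, i₁s]; simp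
  have in₂ : ∀ v ξ, inner ℝ v (i₂ ξ) = inner ℝ v.snd ξ := by
    intro v ξ; rw [prod_in, i₂f, i₂s]; simp
  have nn₁ : ∀ ξ, ‖i₁ ξ‖ ^ 2 = ‖ξ‖ ^ 2 := by intro ξ; rw [prod_nsq, i₁f, i₁s]; simp
  have nn₂ : ∀ ξ, ‖i₂ ξ‖ ^ 2 = ‖ξ‖ ^ 2 := by intro ξ; rw [prod_nsq, i₂f, i₂s]; simp
  have hW₁d : ∀ ξ, W (z + i₁ ξ) - W z = W₁ (z.fst + ξ) - W₁ z.fst := by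
    intro ξ
    simp only [hW, WithLp.add_fst, WithLp.add_snd, i₁f, i₁s, add_zero]; ring
  have hW₂d : ∀ ξ, W (z + i₂ ξ) - W z = W₂ (z.snd + ξ) - W₂ z.snd := by
    intro ξ
    simp only [hW, WithLp.add_fst, WithLp.add_snd, i₂f, i₂s, add_zero]; ring
  have hev₁ : Tendsto i₁ (𝓝 0) (𝓝 0) := by simpa using i₁.continuous.tendsto 0
  have hev₂ : Tendsto i₂ (𝓝 0) (𝓝 0) := by simpa using i₂.continuous.tendsto 0
  refine ⟨q₁ + G.fst, q₂ + G.snd, p₁.comp (T'.comp i₁) + (2 * θ) • ContinuousLinearMap.id ℝ E,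
    p₂.comp (T'.comp i₂) + (2 * θ) • ContinuousLinearMap.id ℝ E, ?_, ?_, ?_, ?_, ?_⟩
  · refine hS₁ (a₁ + X₁ z.fst) (by simpa using hXi₁) _ _ ?_
    filter_upwards [hev₁.eventually hE, Metric.ball_mem_nhds (0 : E) (sub_pos.2 hXi₁)] with ξ hξ hξ2
    have hξ2' : ‖ξ‖ < δ₀ - ‖X₁ z.fst‖ := by simpa using hξ2
    have h1 := hX₁' (z.fst + ξ) (X₁ z.fst + ξ) (by
      have := norm_add_le (X₁ z.fst) ξ
      simp; linarith)
    rw [add_sub_add_right_eq_sub] at h1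
    rw [hW₁d, in₁, in₁, nn₁] at hξ
    have h2 := (abs_le.1 hξ).2
    simp only [hW₁] at h2
    have h3 : U₁ (X₁ z.fst + ξ) - U₁ (X₁ z.fst) ≤ inner ℝ G.fst ξ
        + 1 / 2 * inner ℝ (T' (i₁ ξ)).fst ξ + θ * ‖ξ‖ ^ 2 := by linarith
    simp only [hU₁, inner_add_right] at h3
    simp only [add_apply, smul_apply, ContinuousLinearMap.id_apply, inner_add_left,
        inner_smul_left, conj_trivial, real_inner_self_eq_norm_sq, ContinuousLinearMap.comp_apply, p₁f]
    rw [add_assoc a₁]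
    linarith
  · refine hS₂ (a₂ + X₂ z.snd) (by simpa using hXi₂) _ _ ?_
    filter_upwards [hev₂.eventually hE, Metric.ball_mem_nhds (0 : E) (sub_pos.2 hXi₂)] with ξ hξ hξ2
    have hξ2' : ‖ξ‖ < δ₀ - ‖X₂ z.snd‖ := by simpa using hξ2
    have h1 := hX₂' (z.snd + ξ) (X₂ z.snd + ξ) (by
      have := norm_add_le (X₂ z.snd) ξ
      simp; linarith)
    rw [add_sub_add_right_eq_sub] at h1
    rw [hW₂d, in₂, in₂, nn₂] at hξ
    have h2 := (abs_le.1 hξ).2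
    simp only [hW₂] at h2
    have h3 : U₂ (X₂ z.snd + ξ) - U₂ (X₂ z.snd) ≤ inner ℝ G.snd ξ
        + 1 / 2 * inner ℝ (T' (i₂ ξ)).snd ξ + θ * ‖ξ‖ ^ 2 := by linarith
    simp only [hU₂, inner_add_right] at h3
    simp only [add_apply, smul_apply, ContinuousLinearMap.id_apply, inner_add_left,
        inner_smul_left, conj_trivial, real_inner_self_eq_norm_sq, ContinuousLinearMap.comp_apply, p₂s]
    rw [add_assoc a₂]
    linarith
  · rw [add_sub_cancel_left]; exact (prod_fst_le G).trans hGn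
  · rw [add_sub_cancel_left]; exact (prod_snd_le G).trans hGn
  · intro h
    have hev : ∀ v : WithLp 2 (E × E), Tendsto (fun t : ℝ => t • v) (𝓝[>] 0) (𝓝 0) := by
      intro v
      have : Continuous (fun t : ℝ => t • v) := by fun_prop
      have := this.tendsto 0
      rw [zero_smul] at this
      exact this.mono_left nhdsWithin_le_nhds
    obtain ⟨t, ⟨⟨ht1, ht2⟩, ht3⟩, ht⟩ := (((((hev (i₁ h.fst)).eventually hE).and
      ((hev (i₂ h.snd)).eventually hE)).and ((hev h).eventually hloc)).and self_mem_nhdsWithin).exists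
    have ht : 0 < t := ht
    have hW3 := hWexp (t • h)
    have hsum : W (z + t • h) - W z = (W (z + t • i₁ h.fst) - W z) + (W (z + t • i₂ h.snd) - W z) := by
      rw [← map_smul, ← map_smul, hW₁d, hW₂d]
      simp only [hW, WithLp.add_fst, WithLp.add_snd, WithLp.smul_fst, WithLp.smul_snd]; ring
    have hin : inner ℝ G (t • h) = inner ℝ G (t • i₁ h.fst) + inner ℝ G (t • i₂ h.snd) := by
      rw [← map_smul, ← map_smul, in₁, in₂, prod_in]; rfl
    simp only [map_smul, inner_smul_left, inner_smul_right, conj_trivial, norm_smul, mul_pow,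
      Real.norm_eq_abs, sq_abs, in₁, in₂, nn₁, nn₂, WithLp.smul_fst, WithLp.smul_snd] at ht1 ht2 ht3 hW3 hin
    have h1 := (abs_le.1 ht1).1
    have h2 := (abs_le.1 ht2).1
    have hfin : t ^ 2 * (inner ℝ (T' (i₁ h.fst)).fst h.fst + inner ℝ (T' (i₂ h.snd)).snd h.snd)
        ≤ t ^ 2 * (inner ℝ (B h) h + 2 * θ * ‖h‖ ^ 2 + 2 * θ * (‖h.fst‖ ^ 2 + ‖h.snd‖ ^ 2)) := by
      linarith
    have hfin2 := le_of_mul_le_mul_left hfin (by positivity)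
    rw [← prod_nsq] at hfin2
    have h3 := prod_nsq h
    have h4 : 0 ≤ θ * ‖h‖ ^ 2 := by positivity
    have h5 : 2 * θ * ‖h‖ ^ 2 = 2 * θ * ‖h.fst‖ ^ 2 + 2 * θ * ‖h.snd‖ ^ 2 := by rw [h3]; ring
    simp only [add_apply, smul_apply, ContinuousLinearMap.id_apply, inner_add_left,
        inner_smul_left, conj_trivial, real_inner_self_eq_norm_sq, ContinuousLinearMap.comp_apply, p₁f, p₂s]
    linarith

end Sums

section Jets

variable {N : ℕ}

lemma quad_op (p c : ℝ) (x q : EuclideanSpace ℝ (Fin N))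
    (T : EuclideanSpace ℝ (Fin N) →L[ℝ] EuclideanSpace ℝ (Fin N)) :
    ContDiff ℝ 2 (fun y => c + inner ℝ q (y - x) + 1 / 2 * inner ℝ (T (y - x)) (y - x)) ∧
    pseudoPOp p (fun y => c + inner ℝ q (y - x) + 1 / 2 * inner ℝ (T (y - x)) (y - x)) x =
      ∑ i : Fin N, |q i| ^ (p - 2) *
        inner ℝ (T (EuclideanSpace.single i 1)) (EuclideanSpace.single i 1) := by
  constructor
  · have hs : ContDiff ℝ 2 (fun y : EuclideanSpace ℝ (Fin N) => y - x) := by fun_prop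
    exact (contDiff_const.add (contDiff_const.inner ℝ hs)).add
      (contDiff_const.mul ((T.contDiff.comp hs).inner ℝ hs))
  have h1 : ∀ y, HasFDerivAt (fun y => c + inner ℝ q (y - x) + 1 / 2 * inner ℝ (T (y - x)) (y - x))
      (innerSL ℝ q + (1 / 2 : ℝ) • (innerSL ℝ (T (y - x)) + (innerSL ℝ (y - x)).comp T)) y := by
    intro y
    have hs : HasFDerivAt (fun y : EuclideanSpace ℝ (Fin N) => y - x) (ContinuousLinearMap.id ℝ _) y :=
      (hasFDerivAt_id y).sub_const x
    have hT := T.hasFDerivAt.comp y hs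
    have hq := (innerSL ℝ q).hasFDerivAt.comp y hs
    have hi := HasFDerivAt.inner ℝ hT hs
    have := (hq.const_add c).add (hi.const_mul (1 / 2 : ℝ))
    refine this.congr_fderiv ?_
    ext e
    simp [real_inner_comm, inner_sub_left, inner_sub_right]
    ring
  have h2 : ∀ y e, fderiv ℝ (fun y => c + inner ℝ q (y - x) + 1 / 2 * inner ℝ (T (y - x)) (y - x)) y e
      = inner ℝ q e + 1 / 2 * (inner ℝ (T (y - x)) e + inner ℝ (y - x) (T e)) := by
    intro y e
    rw [(h1 y).fderiv]
    simp only [smul_apply, add_apply, ContinuousLinearMap.comp_apply, innerSL_apply_apply, smul_eq_mul]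
  unfold pseudoPOp
  refine Finset.sum_congr rfl fun i _ => ?_
  simp only [h2]
  have h3 : HasFDerivAt (fun y => inner ℝ q (EuclideanSpace.single i (1 : ℝ)) + 1 / 2 *
      (inner ℝ (T (y - x)) (EuclideanSpace.single i (1 : ℝ))
        + inner ℝ (y - x) (T (EuclideanSpace.single i (1 : ℝ)))))
      ((1 / 2 : ℝ) • ((innerSL ℝ (EuclideanSpace.single i (1 : ℝ))).comp T +
        innerSL ℝ (T (EuclideanSpace.single i (1 : ℝ))))) x := by
    have hs : HasFDerivAt (fun y : EuclideanSpace ℝ (Fin N) => y - x) (ContinuousLinearMap.id ℝ _) x :=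
      (hasFDerivAt_id x).sub_const x
    have hT := T.hasFDerivAt.comp x hs
    have ha := (innerSL ℝ (EuclideanSpace.single i (1 : ℝ))).hasFDerivAt.comp x hT
    have hb := (innerSL ℝ (T (EuclideanSpace.single i (1 : ℝ)))).hasFDerivAt.comp x hs
    have := ((ha.add hb).const_mul (1 / 2 : ℝ)).const_add (inner ℝ q (EuclideanSpace.single i (1 : ℝ)))
    refine (this.congr_fderiv ?_).congr_of_eventuallyEq (Filter.Eventually.of_forall fun y => ?_)
    · ext e; simp
    · simp only [Function.comp, innerSL_apply_apply, Pi.add_apply, real_inner_comm]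
  rw [h3.fderiv]
  congr 1
  · simp [EuclideanSpace.inner_single_right]
  · simp only [smul_apply, add_apply, ContinuousLinearMap.comp_apply, innerSL_apply_apply, smul_eq_mul]
    rw [real_inner_comm]; ring

lemma jet_sub {p K : ℝ} {Ω : Set (EuclideanSpace ℝ (Fin N))} {u f : EuclideanSpace ℝ (Fin N) → ℝ}
    (hu : IsViscSubsol p Ω u f) (hf : ∀ x ∈ Ω, |f x| ≤ K) {x : EuclideanSpace ℝ (Fin N)} (hx : x ∈ Ω)
    (q : EuclideanSpace ℝ (Fin N)) (T : EuclideanSpace ℝ (Fin N) →L[ℝ] EuclideanSpace ℝ (Fin N))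
    (h : ∀ᶠ ξ in 𝓝 (0 : EuclideanSpace ℝ (Fin N)),
      u (x + ξ) ≤ u x + inner ℝ q ξ + 1 / 2 * inner ℝ (T ξ) ξ) :
    -K ≤ ∑ i : Fin N, |q i| ^ (p - 2) *
        inner ℝ (T (EuclideanSpace.single i 1)) (EuclideanSpace.single i 1) := by
  obtain ⟨h1, h2⟩ := quad_op p (u x) x q T
  rw [← h2]
  refine (neg_le_of_abs_le (hf x hx)).trans (hu x hx _ ⟨1, one_pos, h1.contDiffOn⟩ (by simp) ?_)
  have ht : Tendsto (fun y => y - x) (𝓝 x) (𝓝 0) := by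
    have : Continuous (fun y => y - x) := by fun_prop
    simpa using this.tendsto x
  filter_upwards [ht.eventually h] with y hy
  simpa using hy

lemma jet_super {p K : ℝ} {Ω : Set (EuclideanSpace ℝ (Fin N))} {u f : EuclideanSpace ℝ (Fin N) → ℝ}
    (hu : IsViscSupersol p Ω u f) (hf : ∀ x ∈ Ω, |f x| ≤ K) {x : EuclideanSpace ℝ (Fin N)} (hx : x ∈ Ω)
    (q : EuclideanSpace ℝ (Fin N)) (T : EuclideanSpace ℝ (Fin N) →L[ℝ] EuclideanSpace ℝ (Fin N))
    (h : ∀ᶠ ξ in 𝓝 (0 : EuclideanSpace ℝ (Fin N)),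
      - u (x + ξ) ≤ - u x + inner ℝ q ξ + 1 / 2 * inner ℝ (T ξ) ξ) :
    -K ≤ ∑ i : Fin N, |q i| ^ (p - 2) *
        inner ℝ (T (EuclideanSpace.single i 1)) (EuclideanSpace.single i 1) := by
  obtain ⟨h1, h2⟩ := quad_op p (u x) x (-q) (-T)
  have h3 : pseudoPOp p (fun y => u x + inner ℝ (-q) (y - x) + 1 / 2 * inner ℝ ((-T) (y - x)) (y - x)) x
      ≤ f x := by
    refine hu x hx _ ⟨1, one_pos, h1.contDiffOn⟩ (by simp) ?_
    have ht : Tendsto (fun y => y - x) (𝓝 x) (𝓝 0) := by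
      have : Continuous (fun y => y - x) := by fun_prop
      simpa using this.tendsto x
    filter_upwards [ht.eventually h] with y hy
    simp only [add_sub_cancel] at hy
    simp only [neg_apply, inner_neg_left]
    linarith
  have h4 := le_of_abs_le (hf x hx)
  rw [h2] at h3
  simp only [neg_apply, inner_neg_left, PiLp.neg_apply, abs_neg, mul_neg, Finset.sum_neg_distrib] at h3
  linarith

end Jets

section SumsCor

variable {N : ℕ}

/-- the test vectors -/
noncomputable def tvec (s : ℝ) (w q₁ q₂ : EuclideanSpace ℝ (Fin N)) (k : Fin N) :
    WithLp 2 (EuclideanSpace ℝ (Fin N) × EuclideanSpace ℝ (Fin N)) :=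
  WithLp.toLp 2 ((|q₁ k| ^ s) • EuclideanSpace.single k (1 : ℝ),
    (|q₂ k| ^ s) • EuclideanSpace.single k (1 : ℝ)
      - (2 * w k) • ∑ j, (|q₂ j| ^ s * w j) • EuclideanSpace.single j (1 : ℝ))

lemma tvec_cont {s : ℝ} (hs : 0 ≤ s) (w : EuclideanSpace ℝ (Fin N)) (k : Fin N) :
    Continuous (fun x : EuclideanSpace ℝ (Fin N) × EuclideanSpace ℝ (Fin N) => tvec s w x.1 x.2 k) := by
  have h1 : ∀ j, Continuous (fun x : EuclideanSpace ℝ (Fin N) × EuclideanSpace ℝ (Fin N) => |x.1 j| ^ s) := by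
    intro j
    refine Continuous.rpow_const (by fun_prop) (fun x => Or.inr hs)
  have h2 : ∀ j, Continuous (fun x : EuclideanSpace ℝ (Fin N) × EuclideanSpace ℝ (Fin N) => |x.2 j| ^ s) := by
    intro j
    refine Continuous.rpow_const (by fun_prop) (fun x => Or.inr hs)
  unfold tvec
  refine (WithLp.prod_continuous_toLp 2 _ _).comp (Continuous.prodMk ?_ ?_)
  · exact (h1 k).smul continuous_const
  · have h3 : Continuous (fun x : EuclideanSpace ℝ (Fin N) × EuclideanSpace ℝ (Fin N) =>
        ∑ j, (|x.2 j| ^ s * w j) • EuclideanSpace.single j (1 : ℝ)) :=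
      continuous_finsetSum _ fun j _ => ((h2 j).mul continuous_const).smul continuous_const
    exact ((h2 k).smul continuous_const).sub (h3.const_smul (2 * w k))

lemma trace_reflect (T : EuclideanSpace ℝ (Fin N) →L[ℝ] EuclideanSpace ℝ (Fin N))
    (e : Fin N → EuclideanSpace ℝ (Fin N)) (b w : Fin N → ℝ) (hw : ∑ k, w k ^ 2 = 1) :
    ∑ k, inner ℝ (T (b k • e k - (2 * w k) • ∑ j, (b j * w j) • e j))
        (b k • e k - (2 * w k) • ∑ j, (b j * w j) • e j)
      = ∑ k, b k ^ 2 * inner ℝ (T (e k)) (e k) := by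
  set v := ∑ j, (b j * w j) • e j with hv
  have h1 : ∀ k, inner ℝ (T (b k • e k - (2 * w k) • v)) (b k • e k - (2 * w k) • v)
      = b k ^ 2 * inner ℝ (T (e k)) (e k) - 2 * inner ℝ (T ((b k * w k) • e k)) v
        - 2 * inner ℝ (T v) ((b k * w k) • e k) + 4 * w k ^ 2 * inner ℝ (T v) v := by
    intro k
    simp only [map_sub, map_smul, inner_sub_left, inner_sub_right, inner_smul_left, inner_smul_right,
      conj_trivial]
    ring
  simp only [h1, Finset.sum_add_distrib, Finset.sum_sub_distrib, ← Finset.mul_sum, ← Finset.sum_mul,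
    ← inner_sum, ← sum_inner, ← map_sum, ← hv, hw]
  ring

lemma sums_cor {p K : ℝ} (hp : 2 < p) {q₁ q₂ : EuclideanSpace ℝ (Fin N)}
    (B : WithLp 2 (EuclideanSpace ℝ (Fin N) × EuclideanSpace ℝ (Fin N)) →L[ℝ]
      WithLp 2 (EuclideanSpace ℝ (Fin N) × EuclideanSpace ℝ (Fin N)))
    (H : ∀ θ > 0, ∃ (q₁' q₂' : EuclideanSpace ℝ (Fin N))
      (T₁ T₂ : EuclideanSpace ℝ (Fin N) →L[ℝ] EuclideanSpace ℝ (Fin N)),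
      (-K ≤ ∑ i : Fin N, |q₁' i| ^ (p - 2) *
        inner ℝ (T₁ (EuclideanSpace.single i 1)) (EuclideanSpace.single i 1)) ∧
      (-K ≤ ∑ i : Fin N, |q₂' i| ^ (p - 2) *
        inner ℝ (T₂ (EuclideanSpace.single i 1)) (EuclideanSpace.single i 1)) ∧
      ‖q₁' - q₁‖ ≤ θ ∧ ‖q₂' - q₂‖ ≤ θ ∧
      ∀ z : WithLp 2 (EuclideanSpace ℝ (Fin N) × EuclideanSpace ℝ (Fin N)),
        inner ℝ (T₁ z.fst) z.fst + inner ℝ (T₂ z.snd) z.snd ≤ inner ℝ (B z) z + 8 * θ * ‖z‖ ^ 2)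
    (w : EuclideanSpace ℝ (Fin N)) (hw : ∑ k, w k ^ 2 = 1) :
    -(2 * K) ≤ ∑ k, inner ℝ (B (tvec ((p - 2) / 2) w q₁ q₂ k)) (tvec ((p - 2) / 2) w q₁ q₂ k) := by
  have hs : 0 ≤ (p - 2) / 2 := by linarith
  set s := (p - 2) / 2 with hs'
  have H' : ∀ n : ℕ, ∃ q : EuclideanSpace ℝ (Fin N) × EuclideanSpace ℝ (Fin N),
      ‖q.1 - q₁‖ ≤ 1 / ((n : ℝ) + 1) ∧ ‖q.2 - q₂‖ ≤ 1 / ((n : ℝ) + 1) ∧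
      -(2 * K) ≤ ∑ k, (inner ℝ (B (tvec s w q.1 q.2 k)) (tvec s w q.1 q.2 k)
        + 8 * (1 / ((n : ℝ) + 1)) * ‖tvec s w q.1 q.2 k‖ ^ 2) := by
    intro n
    obtain ⟨q₁', q₂', T₁, T₂, h1, h2, h3, h4, h5⟩ := H (1 / ((n : ℝ) + 1)) (by positivity)
    refine ⟨(q₁', q₂'), h3, h4, ?_⟩
    have hpow : ∀ x : ℝ, |x| ^ (p - 2) = (|x| ^ s) ^ 2 := by
      intro x
      rw [← Real.rpow_natCast, ← Real.rpow_mul (abs_nonneg x)]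
      congr 1
      rw [hs']; push_cast; ring
    simp only [hpow] at h1 h2
    rw [← trace_reflect T₂ (fun i => EuclideanSpace.single i 1) (fun i => |q₂' i| ^ s) (fun i => w i) hw] at h2
    have h6 : -(2 * K) ≤ ∑ k, (inner ℝ (T₁ (tvec s w q₁' q₂' k).fst) (tvec s w q₁' q₂' k).fst
        + inner ℝ (T₂ (tvec s w q₁' q₂' k).snd) (tvec s w q₁' q₂' k).snd) := by
      rw [Finset.sum_add_distrib]
      have h7 : ∑ k, inner ℝ (T₁ (tvec s w q₁' q₂' k).fst) (tvec s w q₁' q₂' k).fst =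
          ∑ i : Fin N, (|q₁' i| ^ s) ^ 2 *
        inner ℝ (T₁ (EuclideanSpace.single i 1)) (EuclideanSpace.single i 1) := by
        refine Finset.sum_congr rfl fun k _ => ?_
        change inner ℝ (T₁ ((|q₁' k| ^ s) • EuclideanSpace.single k (1 : ℝ)))
          ((|q₁' k| ^ s) • EuclideanSpace.single k (1 : ℝ)) = _
        rw [map_smul, inner_smul_left, inner_smul_right, conj_trivial]; ring
      rw [h7]
      change -(2 * K) ≤ _ + ∑ k, inner ℝ (T₂ ((|q₂' k| ^ s) • EuclideanSpace.single k (1 : ℝ)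
      - (2 * w k) • ∑ j, (|q₂' j| ^ s * w j) • EuclideanSpace.single j (1 : ℝ)))
        ((|q₂' k| ^ s) • EuclideanSpace.single k (1 : ℝ)
      - (2 * w k) • ∑ j, (|q₂' j| ^ s * w j) • EuclideanSpace.single j (1 : ℝ))
      linarith
    refine h6.trans (Finset.sum_le_sum fun k _ => h5 _)
  choose Q hQ1 hQ2 hQ3 using H'
  have ht0 : Tendsto (fun n : ℕ => 1 / ((n : ℝ) + 1)) atTop (𝓝 0) := tendsto_one_div_add_atTop_nhds_zero_nat
  have hT1 : Tendsto (fun n => (Q n).1) atTop (𝓝 q₁) := by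
    rw [tendsto_iff_norm_sub_tendsto_zero]
    exact squeeze_zero (fun _ => norm_nonneg _) hQ1 ht0
  have hT2 : Tendsto (fun n => (Q n).2) atTop (𝓝 q₂) := by
    rw [tendsto_iff_norm_sub_tendsto_zero]
    exact squeeze_zero (fun _ => norm_nonneg _) hQ2 ht0
  have hT : Tendsto Q atTop (𝓝 (q₁, q₂)) := by
    rw [nhds_prod_eq]; exact hT1.prodMk hT2
  refine ge_of_tendsto' (x := atTop) (f := fun n => ∑ k, (inner ℝ (B (tvec s w (Q n).1 (Q n).2 k)) (tvec s w (Q n).1 (Q n).2 k)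
        + 8 * (1 / ((n : ℝ) + 1)) * ‖tvec s w (Q n).1 (Q n).2 k‖ ^ 2)) ?_ hQ3
  refine tendsto_finsetSum _ fun k _ => ?_
  have hk : Tendsto (fun n => tvec s w (Q n).1 (Q n).2 k) atTop (𝓝 (tvec s w q₁ q₂ k)) :=
    ((tvec_cont hs w k).tendsto (q₁, q₂)).comp hT
  have h1 : Tendsto (fun n => inner ℝ (B (tvec s w (Q n).1 (Q n).2 k)) (tvec s w (Q n).1 (Q n).2 k)) atTop
      (𝓝 (inner ℝ (B (tvec s w q₁ q₂ k)) (tvec s w q₁ q₂ k))) :=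
    ((B.continuous.tendsto _).comp hk).inner hk
  have h2 := ((ht0.const_mul 8).mul (hk.norm.pow 2))
  simpa using h1.add h2

end SumsCor

section Algebra

variable {N : ℕ}

lemma pp_add {n x y : EuclideanSpace ℝ (Fin N)} (hn : ‖n‖ = 1) :
    ‖x + y‖ ^ 2 - inner ℝ n (x + y) ^ 2 ≤ 2 * (‖x‖ ^ 2 - inner ℝ n x ^ 2)
      + 2 * (‖y‖ ^ 2 - inner ℝ n y ^ 2) := by
  have h1 : inner ℝ n (x - y) ^ 2 ≤ ‖x - y‖ ^ 2 := by
    have := abs_real_inner_le_norm n (x - y)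
    rw [hn, one_mul] at this
    rw [← sq_abs]
    gcongr
  rw [norm_sub_sq_real, inner_sub_right] at h1
  rw [norm_add_sq_real, inner_add_right]
  nlinarith

lemma quad_sum {n v : EuclideanSpace ℝ (Fin N)} (hn : ‖n‖ = 1) {A D G : ℝ} (hA : 0 ≤ A) (hAD : A ≤ D)
    {a b w : Fin N → ℝ} (hw : ∑ k, w k ^ 2 = 1) :
    ∑ k, (A * ‖a k • EuclideanSpace.single k (1 : ℝ) -
          (b k • EuclideanSpace.single k (1 : ℝ) - (2 * w k) • v)‖ ^ 2
        - D * inner ℝ n (a k • EuclideanSpace.single k (1 : ℝ) -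
          (b k • EuclideanSpace.single k (1 : ℝ) - (2 * w k) • v)) ^ 2
        + G * ‖a k • EuclideanSpace.single k (1 : ℝ)‖ ^ 2) ≤
      A * (2 * ∑ k, (a k - b k) ^ 2 + 8 * (‖v‖ ^ 2 - inner ℝ n v ^ 2))
        - (D - A) * (2 * inner ℝ n v ^ 2 - ∑ k, (a k - b k) ^ 2) + G * ∑ k, a k ^ 2 := by
  have key : ∀ k, (A * ‖a k • EuclideanSpace.single k (1 : ℝ) -
          (b k • EuclideanSpace.single k (1 : ℝ) - (2 * w k) • v)‖ ^ 2
        - D * inner ℝ n (a k • EuclideanSpace.single k (1 : ℝ) -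
          (b k • EuclideanSpace.single k (1 : ℝ) - (2 * w k) • v)) ^ 2
        + G * ‖a k • EuclideanSpace.single k (1 : ℝ)‖ ^ 2) ≤
      A * (2 * (a k - b k) ^ 2 + 8 * (‖v‖ ^ 2 - inner ℝ n v ^ 2) * w k ^ 2)
        - (D - A) * (2 * inner ℝ n v ^ 2 * w k ^ 2 - (a k - b k) ^ 2) + G * a k ^ 2 := by
    intro k
    have e1 : a k • EuclideanSpace.single k (1 : ℝ) -
          (b k • EuclideanSpace.single k (1 : ℝ) - (2 * w k) • v) =
        (a k - b k) • EuclideanSpace.single k (1 : ℝ) + (2 * w k) • v := by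
      rw [sub_smul]; abel
    rw [e1]
    have h1 := pp_add (x := (a k - b k) • EuclideanSpace.single k (1 : ℝ)) (y := (2 * w k) • v) hn
    have hnk : n k ^ 2 ≤ 1 := by
      have := PiLp.norm_apply_le n k
      rw [hn] at this
      rw [← sq_abs]
      have h2 : |n k| ≤ 1 := this
      nlinarith [abs_nonneg (n k)]
    have i1 : inner ℝ n ((a k - b k) • EuclideanSpace.single k (1 : ℝ)) = (a k - b k) * n k := by
      rw [inner_smul_right]; simp [EuclideanSpace.inner_single_right]
    have i2 : inner ℝ n ((2 * w k) • v) = 2 * w k * inner ℝ n v := by rw [inner_smul_right]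
    have i3 : ‖(a k - b k) • EuclideanSpace.single k (1 : ℝ)‖ ^ 2 = (a k - b k) ^ 2 := by
      rw [norm_smul, mul_pow]; simp
    have i4 : ‖(2 * w k) • v‖ ^ 2 = 4 * w k ^ 2 * ‖v‖ ^ 2 := by
      rw [norm_smul, mul_pow, Real.norm_eq_abs, sq_abs]; ring
    have i5 : ‖a k • EuclideanSpace.single k (1 : ℝ)‖ ^ 2 = a k ^ 2 := by
      rw [norm_smul, mul_pow]; simp
    rw [i1, i2, i3, i4] at h1
    rw [i5]
    have i6 : inner ℝ n ((a k - b k) • EuclideanSpace.single k (1 : ℝ) + (2 * w k) • v)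
        = (a k - b k) * n k + 2 * w k * inner ℝ n v := by rw [inner_add_right, i1, i2]
    rw [i6] at h1 ⊢
    set c := a k - b k
    set h := inner ℝ n v
    have h2 : 2 * h ^ 2 * w k ^ 2 - c ^ 2 ≤ (c * n k + 2 * w k * h) ^ 2 := by
      have h3 : c ^ 2 * n k ^ 2 ≤ c ^ 2 * 1 := by gcongr
      nlinarith [sq_nonneg (2 * (c * n k) + 2 * w k * h)]
    have h4 : (D - A) * (2 * h ^ 2 * w k ^ 2 - c ^ 2) ≤ (D - A) * (c * n k + 2 * w k * h) ^ 2 :=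
      mul_le_mul_of_nonneg_left h2 (by linarith)
    have h5 : 2 * (c ^ 2 - (c * n k) ^ 2) + 2 * (4 * w k ^ 2 * ‖v‖ ^ 2 - (2 * w k * h) ^ 2)
        ≤ 2 * c ^ 2 + 8 * (‖v‖ ^ 2 - h ^ 2) * w k ^ 2 := by
      nlinarith [sq_nonneg (c * n k)]
    have h6 := mul_le_mul_of_nonneg_left (h1.trans h5) hA
    linarith
  refine (Finset.sum_le_sum fun k _ => key k).trans (le_of_eq ?_)
  simp only [Finset.sum_add_distrib, Finset.sum_sub_distrib, ← Finset.mul_sum, hw]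
  ring

lemma good_w {n : EuclideanSpace ℝ (Fin N)} (hn : ‖n‖ = 1) {s m τ : ℝ} (hs : 0 < s) (hm : 0 < m)
    (hτ : 0 < τ) (hτN : N * τ ^ 2 ≤ 1 / 2) :
    ∃ w : EuclideanSpace ℝ (Fin N), ∑ k, w k ^ 2 = 1 ∧
      ∀ v : EuclideanSpace ℝ (Fin N), (∀ j, v j = (m * |n j|) ^ s * w j) →
        ‖v‖ ^ 2 - inner ℝ n v ^ 2 ≤ 2 * N * τ ^ 2 * inner ℝ n v ^ 2 ∧
        1 / 4 * (m ^ (2 * s) * τ ^ (2 * s)) ≤ inner ℝ n v ^ 2 := by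
  classical
  have hn2 : ∑ j, n j ^ 2 = 1 := by
    have := EuclideanSpace.norm_sq_eq n
    rw [hn] at this
    simpa using this.symm
  set c : Fin N → ℝ := fun j => if τ ≤ |n j| then n j else 0 with hc
  set g : Fin N → ℝ := fun j => c j * |n j| ^ (-s) with hg
  set X := ∑ j, c j ^ 2 with hX
  have hX1 : X ≤ 1 := by
    rw [← hn2]; refine Finset.sum_le_sum fun j _ => ?_
    simp only [hc]; split_ifs <;> nlinarith [sq_nonneg (n j)]
  have hX2 : 1 - N * τ ^ 2 ≤ X := by
    have : ∑ j, (n j ^ 2 - c j ^ 2) ≤ ∑ j : Fin N, τ ^ 2 := by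
      refine Finset.sum_le_sum fun j _ => ?_
      simp only [hc]; split_ifs with h
      · simp; positivity
      · push Not at h
        rw [← sq_abs]
        nlinarith [abs_nonneg (n j)]
    rw [Finset.sum_sub_distrib, hn2] at this
    simp at this
    linarith
  set Y := ∑ j, g j ^ 2 with hY
  have hY1 : Y ≤ τ ^ (-(2 * s)) := by
    have : Y ≤ ∑ j, τ ^ (-(2 * s)) * n j ^ 2 := by
      refine Finset.sum_le_sum fun j _ => ?_
      simp only [hg, hc]; split_ifs with h
      · rw [mul_pow, mul_comm]
        gcongr
        rw [← Real.rpow_natCast, ← Real.rpow_mul (abs_nonneg _)]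
        have : (-s) * ((2 : ℕ) : ℝ) = -(2 * s) := by push_cast; ring
        rw [this]
        exact Real.rpow_le_rpow_of_nonpos hτ h (by linarith)
      · simp; positivity
    rwa [← Finset.mul_sum, hn2, mul_one] at this
  have hY0 : 0 < Y := by
    by_contra hcon
    push Not at hcon
    have h0 : Y = 0 := le_antisymm hcon (Finset.sum_nonneg fun j _ => sq_nonneg _)
    rw [hY, Finset.sum_eq_zero_iff_of_nonneg (fun j _ => sq_nonneg _)] at h0
    have : X = 0 := by
      refine Finset.sum_eq_zero fun j hj => ?_
      have h1 := h0 j hj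
      simp only [hg] at h1
      rw [sq_eq_zero_iff, mul_eq_zero] at h1
      rcases h1 with h1 | h1
      · rw [h1]; simp
      · simp only [hc]; split_ifs with h
        · exact absurd h1 (Real.rpow_pos_of_pos (hτ.trans_le h) _).ne'
        · simp
    linarith
  set t := Real.sqrt Y with ht
  have ht0 : 0 < t := Real.sqrt_pos.2 hY0
  have ht2 : t ^ 2 = Y := Real.sq_sqrt hY0.le
  refine ⟨WithLp.toLp 2 (fun j => t⁻¹ * g j), ?_, ?_⟩
  · change ∑ k, (t⁻¹ * g k) ^ 2 = 1
    simp only [mul_pow]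
    rw [← Finset.mul_sum, ← hY, ← ht2, ← mul_pow, inv_mul_cancel₀ ht0.ne', one_pow]
  intro v hv
  have hv' : ∀ j, v j = t⁻¹ * m ^ s * c j := by
    intro j
    rw [hv j]
    change _ * (t⁻¹ * (c j * |n j| ^ (-s))) = _
    rw [Real.mul_rpow hm.le (abs_nonneg _)]
    by_cases h : τ ≤ |n j|
    · have h1 : |n j| ^ s * |n j| ^ (-s) = 1 := by
        rw [← Real.rpow_add (hτ.trans_le h), add_neg_cancel, Real.rpow_zero]
      linear_combination (m ^ s * t⁻¹ * c j) * h1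
    · have : c j = 0 := by simp [hc, h]
      rw [this]; ring
  set y := t⁻¹ * m ^ s with hy
  have hvn : ‖v‖ ^ 2 = y ^ 2 * X := by
    rw [EuclideanSpace.norm_sq_eq, hX, Finset.mul_sum]
    refine Finset.sum_congr rfl fun j _ => ?_
    rw [hv' j, Real.norm_eq_abs, sq_abs]; ring
  have hvi : inner ℝ n v = y * X := by
    rw [PiLp.inner_apply, hX, Finset.mul_sum]
    refine Finset.sum_congr rfl fun j _ => ?_
    rw [hv' j]
    simp only [hc]
    split_ifs <;> simp <;> ring
  have hXh : 1 / 2 ≤ X := by linarith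
  have hy2 : m ^ (2 * s) * τ ^ (2 * s) ≤ y ^ 2 := by
    have e1 : y ^ 2 = m ^ (2 * s) * Y⁻¹ := by
      rw [hy, mul_pow, inv_pow, ht2, mul_comm, ← Real.rpow_natCast, ← Real.rpow_mul hm.le]
      congr 2; push_cast; ring
    rw [e1]
    gcongr
    rw [← inv_inv (τ ^ (2 * s)), ← Real.rpow_neg hτ.le]
    exact inv_anti₀ hY0 hY1
  rw [hvn, hvi]
  constructor
  · have h1 : X * (1 - X) ≤ X * (N * τ ^ 2) := by gcongr; linarith
    have h2 : X * (N * τ ^ 2) ≤ (2 * X) * (X * (N * τ ^ 2)) := by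
      refine le_mul_of_one_le_left (by positivity) (by linarith)
    have h3 := mul_le_mul_of_nonneg_left (h1.trans h2) (sq_nonneg y)
    linarith
  · have h1 : 1 / 4 ≤ X ^ 2 := by nlinarith
    have h2 : y ^ 2 * (1 / 4) ≤ y ^ 2 * X ^ 2 := by gcongr
    nlinarith

lemma rpow_diff {s x y e : ℝ} (hs : 0 < s) (hx : 0 ≤ x) (hy : 0 ≤ y) (hx2 : x ≤ 2) (hy2 : y ≤ 2)
    (he : |x - y| ≤ e) (he1 : e ≤ 1) :
    |x ^ s - y ^ s| ≤ (s * 2 ^ s + 1) * e ^ (min s 1) := by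
  have he0 : 0 ≤ e := (abs_nonneg _).trans he
  wlog hxy : y ≤ x generalizing x y with H
  · rw [abs_sub_comm]; rw [abs_sub_comm] at he
    exact H hy hx hy2 hx2 he (not_le.1 hxy).le
  have h0 : y ^ s ≤ x ^ s := Real.rpow_le_rpow hy hxy hs.le
  rw [abs_of_nonneg (by linarith)]
  rw [abs_of_nonneg (by linarith)] at he
  rcases le_total s 1 with h | h
  · rw [min_eq_left h]
    have h1 := Real.rpow_add_le_add_rpow hy (sub_nonneg.2 hxy) hs.le h
    rw [add_sub_cancel] at h1
    have h2 : (x - y) ^ s ≤ e ^ s := Real.rpow_le_rpow (sub_nonneg.2 hxy) he hs.le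
    have h3 : 0 ≤ e ^ s := by positivity
    have h4 : 0 ≤ s * 2 ^ s * e ^ s := by positivity
    linarith
  · rw [min_eq_right h, Real.rpow_one]
    rcases hxy.eq_or_lt with h1 | h1
    · rw [h1, sub_self]; positivity
    obtain ⟨c, hc, hc'⟩ := exists_deriv_eq_slope (fun t : ℝ => t ^ s) h1
      (by
        apply ContinuousOn.rpow_const (by fun_prop)
        intro t _; exact Or.inr hs.le)
      (by
        intro t ht
        have : t ≠ 0 := by have := ht.1; have : 0 < t := by linarith
                           exact this.ne'
        exact (Real.differentiableAt_rpow_const_of_ne s this).differentiableWithinAt)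
    have hc0 : 0 < c := by linarith [hc.1]
    rw [Real.deriv_rpow_const, eq_div_iff (by linarith)] at hc'
    rw [← hc']
    have h5 : c ^ (s - 1) ≤ 2 ^ s := by
      calc c ^ (s - 1) ≤ 2 ^ (s - 1) := Real.rpow_le_rpow hc0.le (by linarith [hc.2]) (by linarith)
        _ ≤ 2 ^ s := Real.rpow_le_rpow_of_exponent_le (by norm_num) (by linarith)
    calc s * c ^ (s - 1) * (x - y) ≤ s * 2 ^ s * e := by gcongr
      _ ≤ _ := by nlinarith

end Algebra

section Combined

variable {N : ℕ}

lemma pow_pair {p K m e A D G τ : ℝ} (hp : 2 < p) {n g : EuclideanSpace ℝ (Fin N)} (hn : ‖n‖ = 1)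
    (hm : 0 < m) (he1 : e ≤ 1) (hg : ‖g‖ ≤ m * e)
    (hA : 0 ≤ A) (hAD : A ≤ D) (hG : 0 ≤ G) (hτ : 0 < τ) (hτN : N * τ ^ 2 ≤ 1 / 2)
    (hτA : 16 * A * (N * τ ^ 2) ≤ D - A)
    (B : WithLp 2 (EuclideanSpace ℝ (Fin N) × EuclideanSpace ℝ (Fin N)) →L[ℝ]
      WithLp 2 (EuclideanSpace ℝ (Fin N) × EuclideanSpace ℝ (Fin N)))
    (hB : ∀ z, inner ℝ (B z) z = A * ‖z.fst - z.snd‖ ^ 2 - D * inner ℝ n (z.fst - z.snd) ^ 2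
      + G * ‖z.fst‖ ^ 2)
    (H : ∀ w : EuclideanSpace ℝ (Fin N), ∑ k, w k ^ 2 = 1 →
      -(2 * K) ≤ ∑ k, inner ℝ (B (tvec ((p - 2) / 2) w (m • n + g) (-(m • n)) k))
        (tvec ((p - 2) / 2) w (m • n + g) (-(m • n)) k)) :
    -(2 * K) ≤ m ^ (p - 2) * ((A + D) * (N * ((p - 2) / 2 * 2 ^ ((p - 2) / 2) + 1) ^ 2
        * e ^ (2 * min ((p - 2) / 2) 1)) - 1 / 4 * (D - A) * τ ^ (p - 2) + G * (N * 2 ^ (p - 2))) := by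
  set s := (p - 2) / 2 with hs'
  have hs : 0 < s := by rw [hs']; linarith
  have h2s : p - 2 = 2 * s := by rw [hs']; ring
  have he0 : 0 ≤ e := by
    by_contra hcon
    push Not at hcon
    nlinarith [norm_nonneg g]
  set Cs := s * 2 ^ s + 1 with hCs
  obtain ⟨w, hw, hw2⟩ := good_w hn hs hm hτ hτN
  have hH := H w hw
  set v : EuclideanSpace ℝ (Fin N) := ∑ j, (|(-(m • n)) j| ^ s * w j) • EuclideanSpace.single j (1 : ℝ) with hv
  have hq2 : ∀ j, |(-(m • n)) j| = m * |n j| := by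
    intro j
    rw [PiLp.neg_apply, PiLp.smul_apply, abs_neg, smul_eq_mul, abs_mul, abs_of_pos hm]
  have hvj : ∀ j, v j = (m * |n j|) ^ s * w j := by
    intro j
    rw [hv, WithLp.ofLp_sum, Finset.sum_apply, Finset.sum_eq_single j]
    · simp [hm.le, abs_mul, abs_of_pos hm]
    · intro i _ hij
      simp [hij.symm]
    · simp
  obtain ⟨hv1, hv2⟩ := hw2 v hvj
  set a : Fin N → ℝ := fun k => |(m • n + g) k| ^ s with ha
  set b : Fin N → ℝ := fun k => |(-(m • n)) k| ^ s with hb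
  have hQ := quad_sum (v := v) (a := a) (b := b) (w := fun k => w k) (G := G) hn hA hAD hw
  have hH2 : -(2 * K) ≤ A * (2 * ∑ k, (a k - b k) ^ 2 + 8 * (‖v‖ ^ 2 - inner ℝ n v ^ 2))
        - (D - A) * (2 * inner ℝ n v ^ 2 - ∑ k, (a k - b k) ^ 2) + G * ∑ k, a k ^ 2 := by
    refine (hH.trans (le_of_eq ?_)).trans hQ
    refine Finset.sum_congr rfl fun k _ => ?_
    rw [hB]; rfl
  have hnk : ∀ k, |n k| ≤ 1 := fun k => by
    have := PiLp.norm_apply_le n k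
    rwa [hn] at this
  have hgk : ∀ k, |g k| ≤ m * e := fun k => (PiLp.norm_apply_le g k).trans hg
  have hak : ∀ k, a k = m ^ s * |n k + g k / m| ^ s := by
    intro k
    simp only [ha]
    rw [← Real.mul_rpow hm.le (abs_nonneg _)]
    congr 1
    nth_rw 2 [← abs_of_pos hm]
    rw [← abs_mul, PiLp.add_apply, PiLp.smul_apply, smul_eq_mul]
    congr 1
    field_simp
  have hbk : ∀ k, b k = m ^ s * |n k| ^ s := by
    intro k
    simp only [hb]
    rw [hq2, Real.mul_rpow hm.le (abs_nonneg _)]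
  have hgm : ∀ k, |g k / m| ≤ e := by
    intro k
    rw [abs_div, abs_of_pos hm, div_le_iff₀ hm, mul_comm]; exact hgk k
  have hms : (m ^ s) ^ 2 = m ^ (p - 2) := by
    rw [← Real.rpow_natCast, ← Real.rpow_mul hm.le, h2s]; congr 1; push_cast; ring
  have habs : ∀ k, |n k + g k / m| ≤ 2 := fun k => by
    have := abs_add_le (n k) (g k / m)
    linarith [hnk k, hgm k]
  have hdiff : ∀ k, (a k - b k) ^ 2 ≤ m ^ (p - 2) * (Cs ^ 2 * e ^ (2 * min s 1)) := by
    intro k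
    rw [hak, hbk, ← mul_sub, mul_pow, hms]
    gcongr
    have h1 : |(|n k + g k / m| - |n k|)| ≤ e := by
      refine (abs_abs_sub_abs_le_abs_sub _ _).trans ?_
      rw [add_sub_cancel_left]; exact hgm k
    have h2 := rpow_diff hs (abs_nonneg (n k + g k / m)) (abs_nonneg (n k)) (habs k)
      (by linarith [hnk k]) h1 he1
    have h3 : e ^ (2 * min s 1) = (e ^ min s 1) ^ 2 := by
      rw [← Real.rpow_natCast, ← Real.rpow_mul he0]; congr 1; push_cast; ring
    rw [h3, ← mul_pow, ← sq_abs]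
    gcongr
  have hd : ∑ k, (a k - b k) ^ 2 ≤ N * (m ^ (p - 2) * (Cs ^ 2 * e ^ (2 * min s 1))) := by
    refine (Finset.sum_le_sum fun k _ => hdiff k).trans (le_of_eq ?_)
    simp
  have ha2 : ∑ k, a k ^ 2 ≤ N * (m ^ (p - 2) * 2 ^ (p - 2)) := by
    have : ∀ k, a k ^ 2 ≤ m ^ (p - 2) * 2 ^ (p - 2) := by
      intro k
      rw [hak, mul_pow, hms]
      gcongr
      rw [← Real.rpow_natCast, ← Real.rpow_mul (abs_nonneg _)]
      have : s * ((2 : ℕ) : ℝ) = p - 2 := by rw [h2s]; push_cast; ring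
      rw [this]
      exact Real.rpow_le_rpow (abs_nonneg _) (habs k) (by linarith)
    refine (Finset.sum_le_sum fun k _ => this k).trans (le_of_eq ?_)
    simp
  rw [← h2s] at hv2
  set X := m ^ (p - 2) with hX
  set h2 := inner ℝ n v ^ 2 with hh2
  set S := ∑ k, (a k - b k) ^ 2
  have k1 : A * (8 * (‖v‖ ^ 2 - h2)) ≤ (D - A) * h2 := by
    have e1 : A * (8 * (‖v‖ ^ 2 - h2)) ≤ A * (8 * (2 * N * τ ^ 2 * h2)) := by gcongr
    have e2 : 16 * A * (N * τ ^ 2) * h2 ≤ (D - A) * h2 := by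
      apply mul_le_mul_of_nonneg_right hτA; positivity
    linarith
  have k2 : (D - A) * (1 / 4 * (X * τ ^ (p - 2))) ≤ (D - A) * h2 :=
    mul_le_mul_of_nonneg_left hv2 (by linarith)
  have k3 : (A + D) * S ≤ (A + D) * (N * (X * (Cs ^ 2 * e ^ (2 * min s 1)))) :=
    mul_le_mul_of_nonneg_left hd (by linarith)
  have k4 := mul_le_mul_of_nonneg_left ha2 hG
  linarith

end Combined

section Expansion

variable {E : Type*} [NormedAddCommGroup E] [InnerProductSpace ℝ E] [FiniteDimensional ℝ E]

lemma radial {g g' : ℝ → ℝ} {g'' : ℝ} (x : E) (hg : ∀ᶠ t in 𝓝 (‖x‖ ^ 2), HasDerivAt g (g' t) t)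
    (hg' : HasDerivAt g' g'' (‖x‖ ^ 2)) {ϑ : ℝ} (hϑ : 0 < ϑ) :
    ∀ᶠ ξ in 𝓝 (0 : E), g (‖x + ξ‖ ^ 2) ≤ g (‖x‖ ^ 2) + 2 * g' (‖x‖ ^ 2) * inner ℝ x ξ
      + g' (‖x‖ ^ 2) * ‖ξ‖ ^ 2 + 2 * g'' * inner ℝ x ξ ^ 2 + ϑ * ‖ξ‖ ^ 2 := by
  have hexp : Exp2 g (‖x‖ ^ 2) (g' (‖x‖ ^ 2)) (ContinuousLinearMap.toSpanSingleton ℝ g'') := by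
    refine taylor2 (G := g') ?_ hg'.hasFDerivAt
    filter_upwards [hg] with t ht
    refine ht.hasFDerivAt.congr_fderiv ?_
    ext
    simp
  set r := ‖x‖ with hr
  have hr0 : 0 ≤ r := norm_nonneg x
  set ε := ϑ / (2 * (2 * r + 1) ^ 2) with hε
  have hε0 : 0 < ε := by positivity
  have hev := hexp ε hε0
  have ht : Tendsto (fun ξ : E => 2 * inner ℝ x ξ + ‖ξ‖ ^ 2) (𝓝 0) (𝓝 0) := by
    have : Continuous (fun ξ : E => 2 * inner ℝ x ξ + ‖ξ‖ ^ 2) := by fun_prop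
    simpa using this.tendsto 0
  set c := |g''| * (4 * r + 1) with hc
  have hc0 : 0 ≤ c := by positivity
  have hn : ∀ᶠ ξ in 𝓝 (0 : E), ‖ξ‖ < min 1 (ϑ / (c + 1)) := by
    filter_upwards [Metric.ball_mem_nhds (0 : E) (show 0 < min 1 (ϑ / (c + 1)) by positivity)] with ξ hξ
    simpa using hξ
  filter_upwards [ht.eventually hev, hn] with ξ h1 h2
  have h3 : ‖ξ‖ ≤ 1 := (h2.trans_le (min_le_left _ _)).le
  have h4 : ‖ξ‖ * (c + 1) ≤ ϑ := by
    rw [← le_div_iff₀ (by positivity)]; exact (h2.trans_le (min_le_right _ _)).le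
  rw [norm_add_sq_real, add_assoc]
  have hi := abs_real_inner_le_norm x ξ
  rw [← hr] at hi ⊢
  set y := inner ℝ x ξ with hy
  set l := ‖ξ‖ with hl
  have hl0 : 0 ≤ l := norm_nonneg ξ
  set t := 2 * y + l ^ 2 with ht'
  have h5 := (abs_le.1 h1).2
  simp only [ContinuousLinearMap.toSpanSingleton_apply, Real.norm_eq_abs, sq_abs] at h5
  have i1 : inner ℝ (g' (r ^ 2)) t = t * g' (r ^ 2) := rfl
  have i2 : inner ℝ (t • g'') t = t * (t * g'') := rfl
  rw [i1, i2] at h5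
  have htl : |t| ≤ (2 * r + 1) * l := by
    rw [ht']
    refine (abs_add_le _ _).trans ?_
    rw [abs_mul, abs_of_pos (by norm_num : (0 : ℝ) < 2), abs_of_nonneg (sq_nonneg l)]
    nlinarith
  have ht2 : ε * t ^ 2 ≤ ϑ / 2 * l ^ 2 := by
    have : t ^ 2 ≤ ((2 * r + 1) * l) ^ 2 := by rw [← sq_abs]; gcongr
    calc ε * t ^ 2 ≤ ε * ((2 * r + 1) * l) ^ 2 := by gcongr
      _ = ϑ / 2 * l ^ 2 := by rw [hε]; field_simp
  have h6 : 1 / 2 * (t * (t * g'')) - 2 * g'' * y ^ 2 ≤ ϑ / 2 * l ^ 2 := by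
    have e1 : 1 / 2 * (t * (t * g'')) - 2 * g'' * y ^ 2 = 1 / 2 * (g'' * (4 * y + l ^ 2)) * l ^ 2 := by
      rw [ht']; ring
    rw [e1]
    have e2 : g'' * (4 * y + l ^ 2) ≤ ϑ := by
      refine (le_abs_self _).trans ?_
      rw [abs_mul]
      have e3 : |4 * y + l ^ 2| ≤ (4 * r + 1) * l := by
        refine (abs_add_le _ _).trans ?_
        rw [abs_mul, abs_of_pos (by norm_num : (0 : ℝ) < 4), abs_of_nonneg (sq_nonneg l)]
        nlinarith
      calc |g''| * |4 * y + l ^ 2| ≤ |g''| * ((4 * r + 1) * l) := by gcongr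
        _ = l * c := by rw [hc]; ring
        _ ≤ ϑ := by nlinarith
    have : 1 / 2 * (g'' * (4 * y + l ^ 2)) ≤ ϑ / 2 := by linarith
    exact mul_le_mul_of_nonneg_right this (sq_nonneg l)
  have h7 : t * g' (r ^ 2) = 2 * g' (r ^ 2) * y + g' (r ^ 2) * l ^ 2 := by rw [ht']; ring
  linarith

lemma prod_exp {k P : E → ℝ} {x z gk gP n : E} {k₀ P₀ Hk a b : ℝ}
    (hk : ∀ᶠ ξ in 𝓝 (0 : E), 0 ≤ k (x + ξ) ∧ k (x + ξ) ≤ k₀ + inner ℝ gk ξ + Hk * ‖ξ‖ ^ 2)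
    (hP : ∀ᶠ ζ in 𝓝 (0 : E), 0 ≤ P (z + ζ) ∧
      P (z + ζ) ≤ P₀ + inner ℝ gP ζ + (a * ‖ζ‖ ^ 2 - b * inner ℝ n ζ ^ 2))
    (hn : ‖n‖ = 1) :
    ∃ δ > 0, ∀ ξ ζ : E, ‖ξ‖ ≤ δ → ‖ζ‖ ≤ 2 * δ →
      k (x + ξ) * P (z + ζ) ≤ k₀ * P₀ + k₀ * inner ℝ gP ζ + P₀ * inner ℝ gk ξ
        + k₀ * (a * ‖ζ‖ ^ 2 - b * inner ℝ n ζ ^ 2) + P₀ * (Hk * ‖ξ‖ ^ 2) + inner ℝ gk ξ * inner ℝ gP ζ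
        + (‖ξ‖ ^ 2 + ‖ζ‖ ^ 2) := by
  obtain ⟨d₁, hd₁, hk'⟩ := Metric.eventually_nhds_iff_ball.1 hk
  obtain ⟨d₂, hd₂, hP'⟩ := Metric.eventually_nhds_iff_ball.1 hP
  set c := ‖gk‖ * (|a| + |b|) + |Hk| * ‖gP‖ + |Hk| * (|a| + |b|) with hc
  have hc0 : 0 ≤ c := by positivity
  refine ⟨min (min (d₁ / 2) (d₂ / 4)) (min (1 / 2) (1 / (2 * (c + 1)))), by positivity, fun ξ ζ hξ hζ => ?_⟩
  set δ := min (min (d₁ / 2) (d₂ / 4)) (min (1 / 2) (1 / (2 * (c + 1)))) with hδ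
  have a1 : δ ≤ d₁ / 2 := (min_le_left _ _).trans (min_le_left _ _)
  have a2 : δ ≤ d₂ / 4 := (min_le_left _ _).trans (min_le_right _ _)
  have a3 : δ ≤ 1 / 2 := (min_le_right _ _).trans (min_le_left _ _)
  have a4 : δ ≤ 1 / (2 * (c + 1)) := (min_le_right _ _).trans (min_le_right _ _)
  have a5 : 2 * δ * (c + 1) ≤ 1 := by
    rw [le_div_iff₀ (by positivity)] at a4; linarith
  obtain ⟨b1, b2⟩ := hk' ξ (by simp; linarith)
  obtain ⟨b3, b4⟩ := hP' ζ (by simp; linarith)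
  have b5 := mul_le_mul b2 b4 b3 (b1.trans b2)
  set L₁ := inner ℝ gk ξ with hL₁
  set L₂ := inner ℝ gP ζ with hL₂
  set Q₂ := a * ‖ζ‖ ^ 2 - b * inner ℝ n ζ ^ 2 with hQ₂
  have l1 : |L₁| ≤ ‖gk‖ * ‖ξ‖ := abs_real_inner_le_norm _ _
  have l2 : |L₂| ≤ ‖gP‖ * ‖ζ‖ := abs_real_inner_le_norm _ _
  have l3 : |Q₂| ≤ (|a| + |b|) * ‖ζ‖ ^ 2 := by
    have := abs_real_inner_le_norm n ζ
    rw [hn, one_mul] at this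
    have h2 : inner ℝ n ζ ^ 2 ≤ ‖ζ‖ ^ 2 := by rw [← sq_abs]; gcongr
    rw [hQ₂]
    refine (abs_sub _ _).trans ?_
    rw [abs_mul, abs_mul, abs_of_nonneg (sq_nonneg ‖ζ‖), abs_of_nonneg (sq_nonneg (inner ℝ n ζ)), add_mul]
    gcongr
  have n1 := norm_nonneg ξ
  have n2 := norm_nonneg ζ
  set X := ‖ξ‖ with hX
  set Z := ‖ζ‖ with hZ
  set h := |a| + |b| with hh
  have hh0 : 0 ≤ h := by positivity
  have c1 : L₁ * Q₂ ≤ ‖gk‖ * h * (2 * δ) * Z ^ 2 := by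
    calc L₁ * Q₂ ≤ |L₁| * |Q₂| := by rw [← abs_mul]; exact le_abs_self _
      _ ≤ (‖gk‖ * X) * (h * Z ^ 2) := by gcongr
      _ ≤ (‖gk‖ * (2 * δ)) * (h * Z ^ 2) := by gcongr; linarith
      _ = _ := by ring
  have c2 : Hk * X ^ 2 * L₂ ≤ |Hk| * ‖gP‖ * (2 * δ) * X ^ 2 := by
    calc Hk * X ^ 2 * L₂ ≤ |Hk * X ^ 2| * |L₂| := by rw [← abs_mul]; exact le_abs_self _
      _ = |Hk| * X ^ 2 * |L₂| := by rw [abs_mul, abs_of_nonneg (sq_nonneg X)]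
      _ ≤ |Hk| * X ^ 2 * (‖gP‖ * Z) := by gcongr
      _ ≤ |Hk| * X ^ 2 * (‖gP‖ * (2 * δ)) := by gcongr
      _ = _ := by ring
  have c3 : Hk * X ^ 2 * Q₂ ≤ |Hk| * h * (2 * δ) * X ^ 2 := by
    have hZ1 : Z ^ 2 ≤ 2 * δ := by nlinarith
    calc Hk * X ^ 2 * Q₂ ≤ |Hk * X ^ 2| * |Q₂| := by rw [← abs_mul]; exact le_abs_self _
      _ = |Hk| * X ^ 2 * |Q₂| := by rw [abs_mul, abs_of_nonneg (sq_nonneg X)]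
      _ ≤ |Hk| * X ^ 2 * (h * Z ^ 2) := by gcongr
      _ ≤ |Hk| * X ^ 2 * (h * (2 * δ)) := by gcongr
      _ = _ := by ring
  have δ0 : 0 ≤ δ := n1.trans hξ
  have c4 : ‖gk‖ * h * (2 * δ) * Z ^ 2 ≤ 1 * Z ^ 2 := by
    gcongr
    have : 0 ≤ (|Hk| * ‖gP‖ + |Hk| * h) * (2 * δ) := by positivity
    rw [hc] at a5
    linarith
  have c5 : (|Hk| * ‖gP‖ + |Hk| * h) * (2 * δ) * X ^ 2 ≤ 1 * X ^ 2 := by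
    gcongr
    have : 0 ≤ ‖gk‖ * h * (2 * δ) := by positivity
    rw [hc] at a5
    linarith
  linarith

lemma exists_B (n : E) (A D G : ℝ) :
    ∃ B : WithLp 2 (E × E) →L[ℝ] WithLp 2 (E × E), (∀ z h, inner ℝ (B z) h = inner ℝ (B h) z) ∧
      ∀ z, inner ℝ (B z) z = A * ‖z.fst - z.snd‖ ^ 2 - D * inner ℝ n (z.fst - z.snd) ^ 2
        + G * ‖z.fst‖ ^ 2 := by
  set p₁ : WithLp 2 (E × E) →L[ℝ] E := (ContinuousLinearMap.fst ℝ E E).comp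
    (WithLp.prodContinuousLinearEquiv 2 ℝ E E : WithLp 2 (E × E) →L[ℝ] E × E) with hp₁
  set p₂ : WithLp 2 (E × E) →L[ℝ] E := (ContinuousLinearMap.snd ℝ E E).comp
    (WithLp.prodContinuousLinearEquiv 2 ℝ E E : WithLp 2 (E × E) →L[ℝ] E × E) with hp₂
  set C : E →L[ℝ] E := A • ContinuousLinearMap.id ℝ E - D • (innerSL ℝ n).smulRight n with hC
  set B : WithLp 2 (E × E) →L[ℝ] WithLp 2 (E × E) := ((WithLp.prodContinuousLinearEquiv 2 ℝ E E).symm :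
    E × E →L[ℝ] WithLp 2 (E × E)).comp
      ((C.comp (p₁ - p₂) + G • p₁).prod (-(C.comp (p₁ - p₂)))) with hB
  have e1 : ∀ z, (B z).fst = C (z.fst - z.snd) + G • z.fst := fun z => rfl
  have e2 : ∀ z, (B z).snd = - C (z.fst - z.snd) := fun z => rfl
  have e3 : ∀ x y, inner ℝ (C x) y = A * inner ℝ x y - D * (inner ℝ n x * inner ℝ n y) := by
    intro x y
    simp only [hC, sub_apply, smul_apply, ContinuousLinearMap.id_apply, inner_sub_left, inner_smul_left,
      conj_trivial, ContinuousLinearMap.smulRight_apply, innerSL_apply_apply]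
  have e4 : ∀ z h, inner ℝ (B z) h = inner ℝ (C (z.fst - z.snd)) (h.fst - h.snd)
      + G * inner ℝ z.fst h.fst := by
    intro z h
    rw [prod_in, e1, e2, inner_add_left, inner_neg_left, inner_sub_right, inner_smul_left, conj_trivial]
    ring
  refine ⟨B, fun z h => ?_, fun z => ?_⟩
  · rw [e4, e4, e3, e3, real_inner_comm, real_inner_comm z.fst h.fst]; ring
  · rw [e4, e3, real_inner_self_eq_norm_sq, real_inner_self_eq_norm_sq]; ring

end Expansion

section Barrier

variable {E : Type*} [NormedAddCommGroup E] [InnerProductSpace ℝ E] [FiniteDimensional ℝ E]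

noncomputable def kap (R : ℝ) (x : E) : ℝ := ((R ^ 2 - ‖x‖ ^ 2)⁻¹) ^ 2

noncomputable def psi (α : ℝ) (z : E) : ℝ := (‖z‖ ^ 2) ^ (1 / 2 : ℝ) - 1 / 2 * (‖z‖ ^ 2) ^ ((1 + α) / 2)

lemma sq_rpow {ρ : ℝ} (hρ : 0 ≤ ρ) (a : ℝ) : (ρ ^ 2) ^ a = ρ ^ (2 * a) := by
  rw [← Real.rpow_natCast, ← Real.rpow_mul hρ]; norm_num

lemma psi_eq (α : ℝ) (z : E) : psi α z = ‖z‖ - 1 / 2 * ‖z‖ ^ (1 + α) := by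
  unfold psi
  rw [sq_rpow (norm_nonneg z), sq_rpow (norm_nonneg z)]
  congr 1
  · norm_num
  · congr 2; ring

lemma psi_le (α : ℝ) (z : E) : psi α z ≤ ‖z‖ := by
  rw [psi_eq]
  have : 0 ≤ ‖z‖ ^ (1 + α) := by positivity
  linarith

lemma psi_ge {α : ℝ} (hα : 0 < α) {z : E} (hz : ‖z‖ ≤ 1) : ‖z‖ / 2 ≤ psi α z := by
  rw [psi_eq]
  have : ‖z‖ ^ (1 + α) ≤ ‖z‖ := by
    have := Real.rpow_le_rpow_of_exponent_ge' (norm_nonneg z) hz (by norm_num) (by linarith : (1 : ℝ) ≤ 1 + α)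
    rwa [Real.rpow_one] at this
  linarith

lemma kap_exp {R : ℝ} (hR : R ≤ 1) {x : E} (hx : ‖x‖ < R) :
    ∀ᶠ ξ in 𝓝 (0 : E), 0 ≤ kap R (x + ξ) ∧ kap R (x + ξ) ≤ kap R x
      + inner ℝ ((4 * ((R ^ 2 - ‖x‖ ^ 2)⁻¹) ^ 3) • x) ξ + (15 * ((R ^ 2 - ‖x‖ ^ 2)⁻¹) ^ 4) * ‖ξ‖ ^ 2 := by
  have hx0 := norm_nonneg x
  have hd : 0 < R ^ 2 - ‖x‖ ^ 2 := by nlinarith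
  have hd1 : R ^ 2 - ‖x‖ ^ 2 ≤ 1 := by nlinarith
  have hi : ∀ t, R ^ 2 - t ≠ 0 → HasDerivAt (fun t => (R ^ 2 - t)⁻¹) (((R ^ 2 - t)⁻¹) ^ 2) t := by
    intro t ht
    have h1 : HasDerivAt (fun t : ℝ => R ^ 2 - t) (-1) t := by
      simpa using (hasDerivAt_id t).const_sub (R ^ 2)
    refine (h1.inv ht).congr_deriv ?_
    field_simp
  have hg : ∀ t, R ^ 2 - t ≠ 0 → HasDerivAt (fun t => ((R ^ 2 - t)⁻¹) ^ 2) (2 * ((R ^ 2 - t)⁻¹) ^ 3) t := by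
    intro t ht
    refine ((hi t ht).pow 2).congr_deriv ?_
    push_cast; ring
  have hg' : HasDerivAt (fun t => 2 * ((R ^ 2 - t)⁻¹) ^ 3) (6 * ((R ^ 2 - ‖x‖ ^ 2)⁻¹) ^ 4) (‖x‖ ^ 2) := by
    refine (((hi _ hd.ne').pow 3).const_mul 2).congr_deriv ?_
    push_cast; ring
  have hev : ∀ᶠ t in 𝓝 (‖x‖ ^ 2), R ^ 2 - t ≠ 0 := by
    have : Continuous (fun t : ℝ => R ^ 2 - t) := by fun_prop
    exact (this.tendsto _).eventually_ne hd.ne'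
  have := radial x (hev.mono hg) hg' one_pos
  filter_upwards [this] with ξ hξ
  refine ⟨sq_nonneg _, ?_⟩
  unfold kap
  rw [inner_smul_left, conj_trivial]
  set i := (R ^ 2 - ‖x‖ ^ 2)⁻¹ with hi'
  have hi1 : 1 ≤ i := (one_le_inv₀ hd).2 hd1
  have hc : inner ℝ x ξ ^ 2 ≤ ‖ξ‖ ^ 2 := by
    have h1 := abs_real_inner_le_norm x ξ
    have h2 : ‖x‖ * ‖ξ‖ ≤ 1 * ‖ξ‖ := by gcongr; linarith
    rw [← sq_abs]
    gcongr; linarith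
  have h3 : i ^ 4 * inner ℝ x ξ ^ 2 ≤ i ^ 4 * ‖ξ‖ ^ 2 := by gcongr
  have h4 : i ^ 3 * ‖ξ‖ ^ 2 ≤ i ^ 4 * ‖ξ‖ ^ 2 := by gcongr <;> simp [hi1]
  have h5 : 1 * ‖ξ‖ ^ 2 ≤ i ^ 4 * ‖ξ‖ ^ 2 := by gcongr; exact one_le_pow₀ hi1
  linarith

lemma psi_exp {α : ℝ} (hα : 0 < α) {z : E} {ρ : ℝ} (hρ : ρ = ‖z‖) (hρ0 : 0 < ρ) (hρ1 : ρ < 1) :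
    ∀ᶠ ζ in 𝓝 (0 : E), 0 ≤ psi α (z + ζ) ∧ psi α (z + ζ) ≤ psi α z
      + inner ℝ ((1 - 1 / 2 * (1 + α) * ρ ^ α) • (ρ⁻¹ • z)) ζ
      + (((1 - 1 / 2 * (1 + α) * ρ ^ α) / ρ / 2 + 1) * ‖ζ‖ ^ 2
        - 1 / 2 * ((1 - 1 / 2 * (1 + α) * ρ ^ α) / ρ + 1 / 2 * (1 + α) * α * (ρ ^ α / ρ))
          * inner ℝ (ρ⁻¹ • z) ζ ^ 2) := by
  have hg : ∀ t : ℝ, t ≠ 0 → HasDerivAt (fun t : ℝ => t ^ (1 / 2 : ℝ) - 1 / 2 * t ^ ((1 + α) / 2))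
      (1 / 2 * t ^ (-1 / 2 : ℝ) - (1 + α) / 4 * t ^ ((α - 1) / 2)) t := by
    intro t ht
    refine ((Real.hasDerivAt_rpow_const (p := 1 / 2) (Or.inl ht)).sub
      ((Real.hasDerivAt_rpow_const (p := (1 + α) / 2) (Or.inl ht)).const_mul (1 / 2))).congr_deriv ?_
    have e1 : (1 / 2 - 1 : ℝ) = -1 / 2 := by norm_num
    have e2 : ((1 + α) / 2 - 1 : ℝ) = (α - 1) / 2 := by ring
    rw [e1, e2]; ring
  have hz2 : ‖z‖ ^ 2 ≠ 0 := by rw [← hρ]; positivity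
  have hg' : HasDerivAt (fun t : ℝ => 1 / 2 * t ^ (-1 / 2 : ℝ) - (1 + α) / 4 * t ^ ((α - 1) / 2))
      (- (1 / 4) * (‖z‖ ^ 2) ^ (-3 / 2 : ℝ) - (1 + α) / 4 * ((α - 1) / 2) * (‖z‖ ^ 2) ^ ((α - 3) / 2))
      (‖z‖ ^ 2) := by
    refine (((Real.hasDerivAt_rpow_const (p := -1 / 2) (Or.inl hz2)).const_mul (1 / 2)).sub
      ((Real.hasDerivAt_rpow_const (p := (α - 1) / 2) (Or.inl hz2)).const_mul ((1 + α) / 4))).congr_deriv ?_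
    have e1 : (-1 / 2 - 1 : ℝ) = -3 / 2 := by norm_num
    have e2 : ((α - 1) / 2 - 1 : ℝ) = (α - 3) / 2 := by ring
    rw [e1, e2]; ring
  have hev : ∀ᶠ t in 𝓝 (‖z‖ ^ 2), t ≠ 0 := eventually_ne_nhds hz2
  have hrad := radial z (hev.mono hg) hg' one_pos
  have hpos : ∀ᶠ ζ in 𝓝 (0 : E), ‖z + ζ‖ < 1 := by
    have : Continuous (fun ζ : E => ‖z + ζ‖) := by fun_prop
    refine (this.tendsto 0).eventually_lt_const ?_
    simpa [← hρ] using hρ1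
  filter_upwards [hrad, hpos] with ζ h1 h2
  constructor
  · have := psi_ge hα h2.le
    linarith [norm_nonneg (z + ζ)]
  unfold psi
  refine h1.trans (le_of_eq ?_)
  rw [← hρ]
  have r1 : (ρ ^ 2) ^ (-1 / 2 : ℝ) = 1 / ρ := by
    rw [sq_rpow hρ0.le]
    have : (2 * (-1 / 2) : ℝ) = -1 := by norm_num
    rw [this, Real.rpow_neg_one]; simp
  have r2 : (ρ ^ 2) ^ ((α - 1) / 2) = ρ ^ α / ρ := by
    rw [sq_rpow hρ0.le]
    have : (2 * ((α - 1) / 2) : ℝ) = α - 1 := by ring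
    rw [this, Real.rpow_sub_one hρ0.ne']
  have r3 : (ρ ^ 2) ^ (-3 / 2 : ℝ) = 1 / ρ ^ 3 := by
    rw [sq_rpow hρ0.le]
    have : (2 * (-3 / 2) : ℝ) = -((3 : ℕ) : ℝ) := by norm_num
    rw [this, Real.rpow_neg hρ0.le, Real.rpow_natCast]; simp
  have r4 : (ρ ^ 2) ^ ((α - 3) / 2) = ρ ^ α / ρ ^ 3 := by
    rw [sq_rpow hρ0.le]
    have : (2 * ((α - 3) / 2) : ℝ) = α - ((3 : ℕ) : ℝ) := by push_cast; ring
    rw [this, Real.rpow_sub hρ0, Real.rpow_natCast]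
  rw [r1, r2, r3, r4]
  simp only [inner_smul_left, conj_trivial]
  field_simp
  ring

end Barrier

section MainLocal

section Abs

variable {E : Type*} [NormedAddCommGroup E] [InnerProductSpace ℝ E] [FiniteDimensional ℝ E]

set_option maxHeartbeats 1000000 in
lemma barrier_exp {R α ρ d w o : ℝ} (hR : R ≤ 1) (hα : 0 < α) {x y n : E} (hx : ‖x‖ < R)
    (hd : d = R ^ 2 - ‖x‖ ^ 2) (hρ : ρ = ‖x - y‖) (hρ0 : 0 < ρ) (hρ1 : ρ < 1) (hρd : ρ ≤ d ^ 2)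
    (hw : w = 1 - 1 / 2 * (1 + α) * ρ ^ α) (hw0 : 0 ≤ w) (hw1 : w ≤ 1)
    (ho : o = 1 / 2 * (1 + α) * α * (ρ ^ α / ρ)) (hn : n = ρ⁻¹ • (x - y)) :
    ∃ δ > 0, ∀ ξ η : E, ‖ξ‖ ≤ δ → ‖η‖ ≤ δ →
      kap R (x + ξ) * psi α (x + ξ - (y + η)) ≤ kap R x * psi α (x - y)
        + inner ℝ ((d⁻¹ ^ 2 * w) • n + psi α (x - y) • ((4 * d⁻¹ ^ 3) • x)) ξ
        + inner ℝ (-((d⁻¹ ^ 2 * w) • n)) η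
        + 1 / 2 * (d⁻¹ ^ 2 * (w / ρ + 8 * d⁻¹) * ‖ξ - η‖ ^ 2
          - d⁻¹ ^ 2 * (w / ρ + o) * inner ℝ n (ξ - η) ^ 2 + 36 * d⁻¹ ^ 3 * ‖ξ‖ ^ 2) := by
  have hx0 := norm_nonneg x
  have hd0 : 0 < d := by rw [hd]; nlinarith
  have hd1 : d ≤ 1 := by rw [hd]; nlinarith
  have hnn : ‖n‖ = 1 := by
    rw [hn, norm_smul, norm_inv, Real.norm_of_nonneg hρ0.le, ← hρ]; exact inv_mul_cancel₀ hρ0.ne'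
  have hP := psi_exp hα hρ hρ0 hρ1
  rw [← hw, ← ho, ← hn] at hP
  have hk := kap_exp hR hx
  rw [← hd] at hk
  obtain ⟨δ, hδ, H⟩ := prod_exp hk hP hnn
  refine ⟨δ, hδ, fun ξ η hξ hη => ?_⟩
  have h1 := H ξ (ξ - η) hξ ((norm_sub_le ξ η).trans (by linarith))
  have e1 : x - y + (ξ - η) = x + ξ - (y + η) := by abel
  rw [e1] at h1
  refine h1.trans ?_
  have hk0 : kap R x = d⁻¹ ^ 2 := by unfold kap; rw [← hd]
  rw [hk0]
  set i := d⁻¹ with hi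
  have hi1 : 1 ≤ i := (one_le_inv₀ hd0).2 hd1
  set ψ := psi α (x - y) with hψ
  have hψ1 : ψ ≤ ρ := by rw [hρ]; exact psi_le _ _
  have hψ0 : 0 ≤ ψ := by
    have := psi_ge hα (z := x - y) (by rw [← hρ]; exact hρ1.le)
    rw [← hρ] at this; linarith
  set ζ := ξ - η with hζ
  have e2 : inner ℝ n η = inner ℝ n ξ - inner ℝ n ζ := by rw [hζ, inner_sub_right]; ring
  simp only [inner_add_left, inner_neg_left, inner_smul_left, conj_trivial]
  rw [e2]
  have b1 : |inner ℝ x ξ| ≤ ‖ξ‖ := (abs_real_inner_le_norm _ _).trans (by nlinarith [norm_nonneg ξ])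
  have b2 : |inner ℝ n ζ| ≤ ‖ζ‖ := (abs_real_inner_le_norm _ _).trans (by rw [hnn, one_mul])
  have b3 : |inner ℝ x ξ * (w * inner ℝ n ζ)| ≤ ‖ξ‖ * ‖ζ‖ := by
    rw [abs_mul, abs_mul, abs_of_nonneg hw0]
    refine mul_le_mul b1 ?_ (by positivity) (by positivity)
    nlinarith [abs_nonneg (inner ℝ n ζ)]
  have b4 : inner ℝ x ξ * (w * inner ℝ n ζ) ≤ 1 / 2 * (‖ξ‖ ^ 2 + ‖ζ‖ ^ 2) := by
    nlinarith [le_abs_self (inner ℝ x ξ * (w * inner ℝ n ζ)), sq_nonneg (‖ξ‖ - ‖ζ‖)]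
  have i3 : (0 : ℝ) < i ^ 3 := by positivity
  have b5 := mul_le_mul_of_nonneg_left b4 (by positivity : 0 ≤ 4 * i ^ 3)
  have hi2 : i ^ 2 ≤ i ^ 3 := pow_le_pow_right₀ hi1 (by norm_num)
  have hi0 : 1 ≤ i ^ 3 := one_le_pow₀ hi1
  have hψi : ψ * i ^ 4 ≤ i ^ 3 := by
    have : ψ * i ^ 4 ≤ d ^ 2 * i ^ 4 := by
      apply mul_le_mul_of_nonneg_right (hψ1.trans hρd); positivity
    have e : d ^ 2 * i ^ 4 = i ^ 2 := by rw [hi]; field_simp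
    linarith
  have c1 := mul_le_mul_of_nonneg_right hi2 (sq_nonneg ‖ζ‖)
  have c2 := mul_le_mul_of_nonneg_right hi0 (sq_nonneg ‖ζ‖)
  have c3 := mul_le_mul_of_nonneg_right hi0 (sq_nonneg ‖ξ‖)
  have c4 := mul_le_mul_of_nonneg_right hψi (sq_nonneg ‖ξ‖)
  linarith only [c1, c2, c3, c4, b5]

end Abs

variable {N : ℕ}

set_option maxHeartbeats 1000000 in
lemma main_local {p K M R α ρ d w o τ : ℝ} (hp : 2 < p) {u f : EuclideanSpace ℝ (Fin N) → ℝ}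
    (hu : ContinuousOn u (ball 0 1)) (hf : ∀ x ∈ ball (0 : EuclideanSpace ℝ (Fin N)) 1, |f x| ≤ K)
    (hsub : IsViscSubsol p (ball 0 1) u f) (hsup : IsViscSupersol p (ball 0 1) u f)
    (hM : 0 < M) (hR : R ≤ 1) (hα : 0 < α) {x y : EuclideanSpace ℝ (Fin N)} (hx : ‖x‖ < R)
    (hy : ‖y‖ < 1)
    (hd : d = R ^ 2 - ‖x‖ ^ 2) (hρ : ρ = ‖x - y‖) (hρ0 : 0 < ρ) (hρ1 : ρ < 1) (hρd : ρ ≤ d ^ 2)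
    (hw : w = 1 - 1 / 2 * (1 + α) * ρ ^ α) (hw0 : 1 / 3 ≤ w) (hw1 : w ≤ 1)
    (ho : o = 1 / 2 * (1 + α) * α * (ρ ^ α / ρ))
    (hmax : ∃ δ > 0, ∀ ξ η, ‖ξ‖ ≤ δ → ‖η‖ ≤ δ →
      u (x + ξ) - u (y + η) - M * (kap R (x + ξ) * psi α (x + ξ - (y + η)))
        ≤ u x - u y - M * (kap R x * psi α (x - y)))
    (he : 12 * ρ * d⁻¹ ≤ 1) (hτ : 0 < τ) (hτN : N * τ ^ 2 ≤ 1 / 2) (ho8 : 8 * d⁻¹ ≤ o)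
    (hτA : 16 * (w / ρ + 8 * d⁻¹) * (N * τ ^ 2) ≤ o - 8 * d⁻¹) :
    -(2 * K) ≤ (M * d⁻¹ ^ 2 * w) ^ (p - 2) * ((M * d⁻¹ ^ 2) * ((2 * (w / ρ) + 8 * d⁻¹ + o)
      * (N * ((p - 2) / 2 * 2 ^ ((p - 2) / 2) + 1) ^ 2 * (12 * ρ * d⁻¹) ^ (2 * min ((p - 2) / 2) 1))
        - 1 / 4 * (o - 8 * d⁻¹) * τ ^ (p - 2) + 36 * d⁻¹ * (N * 2 ^ (p - 2)))) := by
  have hx0 := norm_nonneg x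
  have hd0 : 0 < d := by rw [hd]; nlinarith
  set n := ρ⁻¹ • (x - y) with hn
  have hnn : ‖n‖ = 1 := by
    rw [hn, norm_smul, norm_inv, Real.norm_of_nonneg hρ0.le, ← hρ]; exact inv_mul_cancel₀ hρ0.ne'
  obtain ⟨δ₁, hδ₁, h1⟩ := barrier_exp hR hα hx hd hρ hρ0 hρ1 hρd hw (by linarith) hw1 ho hn
  obtain ⟨δ₂, hδ₂, h2⟩ := hmax
  set i := d⁻¹ with hi
  have hi0 : 0 < i := inv_pos.2 hd0
  set ψ := psi α (x - y) with hψ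
  have hψ1 : ψ ≤ ρ := by rw [hρ]; exact psi_le _ _
  have hψ0 : 0 ≤ ψ := by
    have := psi_ge hα (z := x - y) (by rw [← hρ]; exact hρ1.le)
    rw [← hρ] at this; linarith
  set A := M * i ^ 2 * (w / ρ + 8 * i) with hA
  set D := M * i ^ 2 * (w / ρ + o) with hD
  set G := M * (36 * i ^ 3) with hG
  set m := M * i ^ 2 * w with hm
  set g := (M * ψ) • ((4 * i ^ 3) • x) with hg
  have hMi : 0 < M * i ^ 2 := by positivity
  obtain ⟨B, hBs, hB⟩ := exists_B n A D G
  have hwρ : 0 < w / ρ := by positivity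
  have hS : ∀ w' : EuclideanSpace ℝ (Fin N), ∑ k, w' k ^ 2 = 1 →
      -(2 * K) ≤ ∑ k, inner ℝ (B (tvec ((p - 2) / 2) w' (m • n + g) (-(m • n)) k))
        (tvec ((p - 2) / 2) w' (m • n + g) (-(m • n)) k) := by
    refine fun w' hw' => sums_cor hp B (fun θ hθ => ?_) w' hw'
    set δ₀ := min (min δ₁ δ₂) (min ((1 - ‖x‖) / 2) ((1 - ‖y‖) / 2)) with hδ₀
    have hδ0 : 0 < δ₀ := lt_min (lt_min hδ₁ hδ₂) (lt_min (by linarith) (by linarith))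
    have l1 : δ₀ ≤ δ₁ := (min_le_left _ _).trans (min_le_left _ _)
    have l2 : δ₀ ≤ δ₂ := (min_le_left _ _).trans (min_le_right _ _)
    have l3 : δ₀ ≤ (1 - ‖x‖) / 2 := (min_le_right _ _).trans (min_le_left _ _)
    have l4 : δ₀ ≤ (1 - ‖y‖) / 2 := (min_le_right _ _).trans (min_le_right _ _)
    have s1 : closedBall x δ₀ ⊆ ball 0 1 := by
      apply closedBall_subset_ball'
      rw [dist_zero_right]; linarith
    have s2 : closedBall y δ₀ ⊆ ball 0 1 := by
      apply closedBall_subset_ball'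
      rw [dist_zero_right]; linarith
    refine theorem_on_sums (u₁ := u) (u₂ := fun z => - u z) hδ0 (hu.mono s1) (hu.mono s2).neg
      (fun q T => -K ≤ ∑ i : Fin N, |q i| ^ (p - 2) *
        inner ℝ (T (EuclideanSpace.single i 1)) (EuclideanSpace.single i 1))
      (fun x' hx' q T h => jet_sub hsub hf (s1 (ball_subset_closedBall hx')) q T h)
      (fun x' hx' q T h => jet_super hsup hf (s2 (ball_subset_closedBall hx')) q T h) B hBs ?_ hθ
    intro z hz1 hz2
    rw [mem_closedBall, dist_zero_right] at hz1 hz2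
    have k1 := h1 z.fst z.snd (hz1.trans l1) (hz2.trans l1)
    have k2 := h2 z.fst z.snd (hz1.trans l2) (hz2.trans l2)
    have k3 := mul_le_mul_of_nonneg_left k1 hM.le
    rw [hB, hA, hD, hG, hg, hm]
    simp only [inner_add_left, inner_neg_left, inner_smul_left, conj_trivial] at k3 ⊢
    linarith only [k2, k3]
  have hgn : ‖g‖ ≤ m * (12 * ρ * i) := by
    rw [hg, norm_smul, norm_smul, Real.norm_of_nonneg (by positivity), Real.norm_of_nonneg (by positivity), hm]
    have a1 : M * ψ * (4 * i ^ 3 * ‖x‖) ≤ M * ρ * (4 * i ^ 3 * 1) := by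
      gcongr; linarith
    have a2 : M * i ^ 3 * ρ * (1 / 3) ≤ M * i ^ 3 * ρ * w := by gcongr
    nlinarith
  have key := pow_pair hp hnn (by positivity : 0 < m) he hgn (by positivity : 0 ≤ A)
    (by rw [hA, hD]; gcongr) (by positivity : 0 ≤ G) hτ hτN
    (by rw [hA, hD]; nlinarith [mul_le_mul_of_nonneg_left hτA hMi.le]) B hB hS
  refine key.trans (le_of_eq ?_)
  rw [hA, hD, hG]; ring

end MainLocal

section Numerics

set_option maxHeartbeats 2000000 in
lemma num_core {N p ν α θ s Cs ε c ρ d w o : ℝ} (hN : 1 ≤ N) (hp : 2 < p) (hν0 : 0 < ν) (hν1 : ν ≤ 1)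
    (hνp : ν ≤ p - 2) (hα : α = ν / p) (hθ : θ = ν / 2) (hs : s = (p - 2) / 2)
    (hc : c = α / (128 * N)) (hε0 : 0 < ε) (hε1 : ε ≤ 1 / 12) (hε2 : 32 * ε ^ (1 / 2 : ℝ) ≤ α)
    (hε3 : 48 * (N * Cs ^ 2) * ε ^ θ + 36 * (N * 2 ^ (p - 2)) * ε ^ (1 / 2 : ℝ) ≤ α * c ^ s / 32)
    (hρ0 : 0 < ρ) (hd0 : 0 < d) (hd1 : d ≤ 1) (hρ : ρ ≤ ε * d ^ 2)
    (hw : w = 1 - 1 / 2 * (1 + α) * ρ ^ α) (ho : o = 1 / 2 * (1 + α) * α * (ρ ^ α / ρ)) :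
    ρ < 1 ∧ ρ ≤ d ^ 2 ∧ 1 / 3 ≤ w ∧ w ≤ 1 ∧ 12 * ρ * d⁻¹ ≤ 1 ∧ 8 * d⁻¹ ≤ o ∧
    ∃ τ > 0, N * τ ^ 2 ≤ 1 / 2 ∧ 16 * (w / ρ + 8 * d⁻¹) * (N * τ ^ 2) ≤ o - 8 * d⁻¹ ∧
      (2 * (w / ρ) + 8 * d⁻¹ + o)
      * (N * Cs ^ 2 * (12 * ρ * d⁻¹) ^ (2 * min s 1))
        - 1 / 4 * (o - 8 * d⁻¹) * τ ^ (p - 2) + 36 * d⁻¹ * (N * 2 ^ (p - 2)) ≤ - (α * c ^ s / 32) := by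
  have hα0 : 0 < α := by rw [hα]; positivity
  have hα3 : α ≤ 1 / 3 := by rw [hα, div_le_iff₀ (by linarith)]; linarith
  have hs0 : 0 < s := by rw [hs]; linarith
  have hd2 : d ^ 2 ≤ 1 := by nlinarith
  have hρd : ρ ≤ d ^ 2 := by nlinarith
  have hρ1 : ρ < 1 := by nlinarith
  have hra1 : ρ ^ α ≤ 1 := Real.rpow_le_one hρ0.le hρ1.le hα0.le
  have hra0 : 0 < ρ ^ α := Real.rpow_pos_of_pos hρ0 _
  have hw0 : 1 / 3 ≤ w := by rw [hw]; nlinarith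
  have hw1 : w ≤ 1 := by rw [hw]; nlinarith
  set i := d⁻¹ with hi
  have hi0 : 0 < i := inv_pos.2 hd0
  have hdi : d * i = 1 := mul_inv_cancel₀ hd0.ne'
  have hsq : ρ ^ (1 / 2 : ℝ) ≤ ε ^ (1 / 2 : ℝ) * d := by
    have h1 := Real.rpow_le_rpow hρ0.le hρ (by norm_num : (0 : ℝ) ≤ 1 / 2)
    rw [Real.mul_rpow hε0.le (by positivity), sq_rpow hd0.le] at h1
    norm_num at h1
    norm_num
    exact h1
  have hε12 : 0 < ε ^ (1 / 2 : ℝ) := Real.rpow_pos_of_pos hε0 _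
  have hρ12 : 0 < ρ ^ (1 / 2 : ℝ) := Real.rpow_pos_of_pos hρ0 _
  -- `i ≤ ε^(1/2) ρ^(-1/2)`
  have hib : i ≤ ε ^ (1 / 2 : ℝ) * ρ ^ (-(1 / 2) : ℝ) := by
    rw [Real.rpow_neg hρ0.le, ← div_eq_mul_inv, le_div_iff₀ hρ12]
    nlinarith
  have hpow : ∀ a : ℝ, a ≤ -(1 / 2) → i ≤ ε ^ (1 / 2 : ℝ) * ρ ^ a := by
    intro a ha
    refine hib.trans ?_
    exact mul_le_mul_of_nonneg_left (Real.rpow_le_rpow_of_exponent_ge hρ0 hρ1.le ha) hε12.le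
  have hdiv : ρ ^ α / ρ = ρ ^ (α - 1) := by
    rw [Real.rpow_sub hρ0, Real.rpow_one]
  have hq0 : 0 < ρ ^ α / ρ := by positivity
  have ho1 : 1 / 2 * α * (ρ ^ α / ρ) ≤ o := by
    rw [ho]; nlinarith [mul_pos hα0 hq0, mul_pos hα0 (mul_pos hα0 hq0)]
  have ho2 : 16 * i ≤ o := by
    have h1 := hpow (α - 1) (by linarith)
    rw [← hdiv] at h1
    have h2 := mul_le_mul_of_nonneg_right hε2 hq0.le
    linarith only [h1, h2, ho1]
  have ho3 : o ≤ 1 / ρ := by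
    rw [ho, ← mul_div_assoc]
    gcongr
    have : (1 + α) * α ≤ 1 := by nlinarith only [hα0, hα3]
    have : (1 + α) * α * ρ ^ α ≤ 1 * 1 := mul_le_mul this hra1 hra0.le (by norm_num)
    linarith
  have hwr : w / ρ ≤ 1 / ρ := by gcongr
  have hρi : 0 < 1 / ρ := by positivity
  have hc0 : 0 < c := by rw [hc]; positivity
  have hNc : N * c = α / 128 := by rw [hc]; field_simp
  have he : 12 * ρ * i ≤ 1 := by
    have : ρ * i ≤ ε * d ^ 2 * i := by gcongr
    have e : ε * d ^ 2 * i = ε * d := by rw [pow_two, mul_assoc, mul_assoc, hdi, mul_one]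
    nlinarith
  refine ⟨hρ1, hρd, hw0, hw1, he, by linarith, (c * ρ ^ α) ^ (1 / 2 : ℝ), by positivity, ?_⟩
  have ht2 : ((c * ρ ^ α) ^ (1 / 2 : ℝ)) ^ 2 = c * ρ ^ α := by
    rw [← Real.rpow_natCast, ← Real.rpow_mul (by positivity)]; norm_num
  have htp : ((c * ρ ^ α) ^ (1 / 2 : ℝ)) ^ (p - 2) = c ^ s * ρ ^ (α * s) := by
    rw [← Real.rpow_mul (by positivity), Real.mul_rpow hc0.le hra0.le, ← Real.rpow_mul hρ0.le, hs]
    congr 2 <;> ring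
  rw [ht2, htp, ← mul_assoc N, hNc]
  refine ⟨by nlinarith, ?_, ?_⟩
  · have h1 : 16 * (w / ρ + 8 * i) * (α / 128 * ρ ^ α) ≤ 16 * (2 * (1 / ρ)) * (α / 128 * ρ ^ α) := by
      gcongr; linarith
    have e : 16 * (2 * (1 / ρ)) * (α / 128 * ρ ^ α) = 1 / 4 * α * (ρ ^ α / ρ) := by field_simp; norm_num
    linarith
  · have hθ1 : ρ ^ (θ - 1) = (1 / ρ) * ρ ^ θ := by
      rw [Real.rpow_sub hρ0, Real.rpow_one]; ring
    have hθ2 : ρ ^ α / ρ * ρ ^ (α * s) = ρ ^ (θ - 1) := by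
      rw [hdiv, ← Real.rpow_add hρ0]
      congr 1
      rw [hα, hθ, hs]; field_simp; ring
    have hcs : 0 < c ^ s := Real.rpow_pos_of_pos hc0 _
    have hrs : 0 < ρ ^ (α * s) := Real.rpow_pos_of_pos hρ0 _
    have g1 : 1 / 4 * (1 / 4 * α * (ρ ^ α / ρ)) * (c ^ s * ρ ^ (α * s))
        ≤ 1 / 4 * (o - 8 * i) * (c ^ s * ρ ^ (α * s)) := by
      gcongr; linarith
    have g1' : 1 / 4 * (1 / 4 * α * (ρ ^ α / ρ)) * (c ^ s * ρ ^ (α * s))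
        = α * c ^ s / 16 * ρ ^ (θ - 1) := by rw [← hθ2]; ring
    have hmin : ν ≤ 2 * min s 1 := by
      rcases le_total s 1 with h | h
      · rw [min_eq_left h, hs]; linarith
      · rw [min_eq_right h]; linarith
    have g2 : (12 * ρ * i) ^ (2 * min s 1) ≤ 12 * (ε ^ θ * ρ ^ θ) := by
      have h0 : 0 < 12 * ρ * i := by positivity
      have h1 := Real.rpow_le_rpow_of_exponent_ge h0 he hmin
      have h2 : 12 * ρ * i ≤ 12 * (ε * ρ) ^ (1 / 2 : ℝ) := by
        rw [Real.mul_rpow hε0.le hρ0.le]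
        have e : ρ = ρ ^ (1 / 2 : ℝ) * ρ ^ (1 / 2 : ℝ) := by
          rw [← Real.rpow_add hρ0]; norm_num
        have h3 : ρ * i ≤ ρ ^ (1 / 2 : ℝ) * (ε ^ (1 / 2 : ℝ)) := by
          have : ρ * i = ρ ^ (1 / 2 : ℝ) * (ρ ^ (1 / 2 : ℝ) * i) := by rw [← mul_assoc, ← e]
          rw [this]
          gcongr
          calc ρ ^ (1 / 2 : ℝ) * i ≤ ε ^ (1 / 2 : ℝ) * d * i := by gcongr
            _ = ε ^ (1 / 2 : ℝ) := by rw [mul_assoc, hdi, mul_one]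
        linarith
      have h4 := Real.rpow_le_rpow h0.le h2 hν0.le
      have h5 : (12 * (ε * ρ) ^ (1 / 2 : ℝ)) ^ ν ≤ 12 * (ε ^ θ * ρ ^ θ) := by
        rw [Real.mul_rpow (by norm_num) (by positivity), ← Real.rpow_mul (by positivity),
          Real.mul_rpow hε0.le hρ0.le]
        have e : (1 / 2 : ℝ) * ν = θ := by rw [hθ]; ring
        rw [e]
        have : (12 : ℝ) ^ ν ≤ 12 := by
          have := Real.rpow_le_rpow_of_exponent_le (by norm_num : (1 : ℝ) ≤ 12) hν1
          rwa [Real.rpow_one] at this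
        gcongr
      linarith
    have g3 : (2 * (w / ρ) + 8 * i + o) * (N * Cs ^ 2 * (12 * ρ * i) ^ (2 * min s 1))
        ≤ (4 * (1 / ρ)) * (N * Cs ^ 2 * (12 * (ε ^ θ * ρ ^ θ))) := by
      gcongr
      linarith
    have g3' : (4 * (1 / ρ)) * (N * Cs ^ 2 * (12 * (ε ^ θ * ρ ^ θ)))
        = 48 * (N * Cs ^ 2) * ε ^ θ * ρ ^ (θ - 1) := by rw [hθ1]; ring
    have g4 : 36 * i * (N * 2 ^ (p - 2)) ≤ 36 * (ε ^ (1 / 2 : ℝ) * ρ ^ (θ - 1)) * (N * 2 ^ (p - 2)) := by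
      gcongr
      exact hpow _ (by rw [hθ]; linarith)
    have g5 : 1 ≤ ρ ^ (θ - 1) :=
      Real.one_le_rpow_of_pos_of_le_one_of_nonpos hρ0 hρ1.le (by rw [hθ]; linarith)
    have g6 := mul_le_mul_of_nonneg_right hε3 (by linarith : 0 ≤ ρ ^ (θ - 1))
    have g7 : α * c ^ s / 32 * 1 ≤ α * c ^ s / 32 * ρ ^ (θ - 1) := by gcongr
    linarith

lemma num_ev (p θ α κ C₁ C₂ : ℝ) (hθ : 0 < θ) (hα : 0 < α) (hκ : 0 < κ) :
    ∀ᶠ M₀ : ℝ in atTop, 4 / M₀ ≤ 1 / 12 ∧ 32 * (4 / M₀) ^ (1 / 2 : ℝ) ≤ α ∧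
      C₁ * (4 / M₀) ^ θ + C₂ * (4 / M₀) ^ (1 / 2 : ℝ) ≤ κ ∧ 2 * 3 ^ (p - 2) / κ < M₀ := by
  have t0 : Tendsto (fun M₀ : ℝ => 4 / M₀) atTop (𝓝 0) := tendsto_const_nhds.div_atTop tendsto_id
  have tr : ∀ a : ℝ, 0 < a → Tendsto (fun M₀ : ℝ => (4 / M₀) ^ a) atTop (𝓝 0) := by
    intro a ha
    have := t0.rpow_const (p := a) (Or.inr ha.le)
    rwa [Real.zero_rpow ha.ne'] at this
  have t1 : Tendsto (fun M₀ : ℝ => 32 * (4 / M₀) ^ (1 / 2 : ℝ)) atTop (𝓝 0) := by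
    simpa using (tr (1 / 2) (by norm_num)).const_mul 32
  have t2 : Tendsto (fun M₀ : ℝ => C₁ * (4 / M₀) ^ θ + C₂ * (4 / M₀) ^ (1 / 2 : ℝ)) atTop (𝓝 0) := by
    simpa using ((tr θ hθ).const_mul C₁).add ((tr (1 / 2) (by norm_num)).const_mul C₂)
  filter_upwards [t0.eventually_le_const (by norm_num : (0 : ℝ) < 1 / 12), t1.eventually_le_const hα,
    t2.eventually_le_const hκ, eventually_gt_atTop (2 * 3 ^ (p - 2) / κ)] with M₀ h1 h2 h3 h4
  exact ⟨h1, h2, h3, h4⟩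

variable {N : ℕ}

set_option maxHeartbeats 2000000 in
/-- No interior maximum of the doubled function can exist. -/
lemma no_max (hN : 1 ≤ N) {p : ℝ} (hp : 2 < p) :
    ∃ α : ℝ, 0 < α ∧ ∀ᶠ M₀ : ℝ in atTop, ∀ (L K R : ℝ) (u f : EuclideanSpace ℝ (Fin N) → ℝ)
      (x y : EuclideanSpace ℝ (Fin N)), 0 < L → K ≤ L ^ (p - 1) →
      ContinuousOn u (ball 0 1) → (∀ x ∈ ball (0 : EuclideanSpace ℝ (Fin N)) 1, |f x| ≤ K) →
      IsViscSubsol p (ball 0 1) u f → IsViscSupersol p (ball 0 1) u f →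
      R ≤ 1 → ‖x‖ < R → ‖y‖ < 1 → x ≠ y → ‖x - y‖ ≤ 4 / M₀ * (R ^ 2 - ‖x‖ ^ 2) ^ 2 →
      (∃ δ > 0, ∀ ξ η, ‖ξ‖ ≤ δ → ‖η‖ ≤ δ →
        u (x + ξ) - u (y + η) - (L * M₀) * (kap R (x + ξ) * psi α (x + ξ - (y + η)))
          ≤ u x - u y - (L * M₀) * (kap R x * psi α (x - y))) → False := by
  set ν := min 1 (p - 2) with hν
  have hν0 : 0 < ν := lt_min one_pos (by linarith)
  have hν1 : ν ≤ 1 := min_le_left _ _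
  have hνp : ν ≤ p - 2 := min_le_right _ _
  set α := ν / p with hα
  set θ := ν / 2 with hθ
  set s := (p - 2) / 2 with hs
  set Cs := s * 2 ^ s + 1 with hCs
  set c := α / (128 * (N : ℝ)) with hc
  have hN' : (1 : ℝ) ≤ N := by exact_mod_cast hN
  have hα0 : 0 < α := by positivity
  have hc0 : 0 < c := by positivity
  set κ := α * c ^ s / 32 with hκ
  have hκ0 : 0 < κ := by positivity
  refine ⟨α, hα0, ?_⟩
  filter_upwards [num_ev p θ α κ (48 * (N * Cs ^ 2)) (36 * (N * 2 ^ (p - 2))) (by positivity) hα0 hκ0,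
    eventually_ge_atTop 1] with M₀ ⟨h1, h2, h3, h4⟩ hM1
  intro L K R u f x y hL hK hu hf hsub hsup hR hx hy hxy hρ hmax
  have hM0 : 0 < M₀ := by linarith
  have hx0 := norm_nonneg x
  have hd0 : 0 < R ^ 2 - ‖x‖ ^ 2 := by nlinarith
  have hd1 : R ^ 2 - ‖x‖ ^ 2 ≤ 1 := by nlinarith
  set d := R ^ 2 - ‖x‖ ^ 2 with hd
  have hρ0 : 0 < ‖x - y‖ := norm_pos_iff.2 (sub_ne_zero.2 hxy)
  set ρ := ‖x - y‖ with hρ'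
  obtain ⟨a1, a2, a3, a4, a5, a6, τ, hτ, b1, b2, b3⟩ := num_core hN' hp hν0 hν1 hνp hα hθ hs hc
    (by positivity) h1 h2 h3 hρ0 hd0 hd1 hρ rfl rfl
  have key := main_local hp hu hf hsub hsup (by positivity : 0 < L * M₀) hR hα0 hx hy hd hρ' hρ0 a1 a2
    rfl a3 a4 rfl hmax a5 hτ b1 a6 b2
  set w := 1 - 1 / 2 * (1 + α) * ρ ^ α with hw
  have hi1 : 1 ≤ d⁻¹ := (one_le_inv₀ hd0).2 hd1
  have hi2 : 1 ≤ d⁻¹ ^ 2 := one_le_pow₀ hi1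
  have hLM : 0 < L * M₀ := by positivity
  have hMi : L * M₀ ≤ L * M₀ * d⁻¹ ^ 2 := le_mul_of_one_le_right hLM.le hi2
  have c1 : (L * M₀ / 3) ^ (p - 2) ≤ (L * M₀ * d⁻¹ ^ 2 * w) ^ (p - 2) := by
    apply Real.rpow_le_rpow (by positivity) _ (by linarith)
    calc L * M₀ / 3 = L * M₀ * (1 / 3) := by ring
      _ ≤ L * M₀ * d⁻¹ ^ 2 * w := by gcongr
  have c2 : (L * M₀ / 3) ^ (p - 2) * (L * M₀) ≤ (L * M₀ * d⁻¹ ^ 2 * w) ^ (p - 2) * (L * M₀ * d⁻¹ ^ 2) := by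
    gcongr
  have c3 : (L * M₀ / 3) ^ (p - 2) * (L * M₀) = L ^ (p - 1) * M₀ ^ (p - 1) / 3 ^ (p - 2) := by
    rw [Real.div_rpow (by positivity) (by norm_num)]
    rw [← Real.mul_rpow hL.le hM0.le]
    have : (L * M₀) ^ (p - 1) = (L * M₀) ^ (p - 2) * (L * M₀) := by
      rw [← Real.rpow_add_one hLM.ne']; congr 1; ring
    rw [this]; ring
  have c4 : M₀ ≤ M₀ ^ (p - 1) := by
    have := Real.rpow_le_rpow_of_exponent_le hM1 (by linarith : 1 ≤ p - 1)
    rwa [Real.rpow_one] at this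
  have hLp : 0 < L ^ (p - 1) := Real.rpow_pos_of_pos hL _
  have h3p : (0 : ℝ) < 3 ^ (p - 2) := by positivity
  have c5 : 2 * 3 ^ (p - 2) < M₀ ^ (p - 1) * κ := by
    rw [div_lt_iff₀ hκ0] at h4
    exact h4.trans_le (mul_le_mul_of_nonneg_right c4 hκ0.le)
  have c6 : 2 * L ^ (p - 1) < (L * M₀ / 3) ^ (p - 2) * (L * M₀) * κ := by
    rw [c3, div_mul_eq_mul_div, lt_div_iff₀ h3p]
    have := mul_lt_mul_of_pos_left c5 hLp
    linarith only [this]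
  have c7 : (L * M₀ / 3) ^ (p - 2) * (L * M₀) * κ ≤
      (L * M₀ * d⁻¹ ^ 2 * w) ^ (p - 2) * (L * M₀ * d⁻¹ ^ 2) * κ := by gcongr
  have hw0 : 0 < w := by linarith
  rw [← hκ] at b3
  have c8 := mul_le_mul_of_nonneg_left b3
    (by positivity : 0 ≤ (L * M₀ * d⁻¹ ^ 2 * w) ^ (p - 2) * (L * M₀ * d⁻¹ ^ 2))
  rw [mul_assoc ((L * M₀ * d⁻¹ ^ 2 * w) ^ (p - 2)), mul_assoc ((L * M₀ * d⁻¹ ^ 2 * w) ^ (p - 2))] at c8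
  rw [mul_assoc ((L * M₀ * d⁻¹ ^ 2 * w) ^ (p - 2))] at c7
  have c9 := key.trans c8
  have c10 := c6.trans_le c7
  rw [mul_neg, mul_neg] at c9
  linarith only [c9, c10, hK]

end Numerics

section Final

lemma psi_cont {E : Type*} [NormedAddCommGroup E] [InnerProductSpace ℝ E] [FiniteDimensional ℝ E]
    {α : ℝ} (hα : 0 < α) : Continuous (psi α : E → ℝ) := by
  have : (psi α : E → ℝ) = fun z => ‖z‖ - 1 / 2 * ‖z‖ ^ (1 + α) := funext (psi_eq α)
  rw [this]
  have h : Continuous (fun z : E => ‖z‖ ^ (1 + α)) :=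
    continuous_norm.rpow_const (fun _ => Or.inr (by linarith))
  fun_prop

variable {N : ℕ}

set_option maxHeartbeats 2000000 in
lemma max_interior {α M₀ L R ρ₀ : ℝ} {u : EuclideanSpace ℝ (Fin N) → ℝ} (hα : 0 < α) (hM₀ : 0 < M₀)
    (hL : 0 < L) (hR0 : 0 < R) (hR1 : R < 1) (hρ₀ : ρ₀ = (1 - R) / 2) (hM₀ρ : 4 / ρ₀ < M₀)
    (hu : ContinuousOn u (ball 0 1)) (hub : ∀ x ∈ ball (0 : EuclideanSpace ℝ (Fin N)) 1, |u x| ≤ L)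
    (hno : ∀ x y : EuclideanSpace ℝ (Fin N), ‖x‖ < R → ‖y‖ < 1 → x ≠ y →
      ‖x - y‖ ≤ 4 / M₀ * (R ^ 2 - ‖x‖ ^ 2) ^ 2 →
      (∃ δ > 0, ∀ ξ η, ‖ξ‖ ≤ δ → ‖η‖ ≤ δ →
        u (x + ξ) - u (y + η) - (L * M₀) * (kap R (x + ξ) * psi α (x + ξ - (y + η)))
          ≤ u x - u y - (L * M₀) * (kap R x * psi α (x - y))) → False)
    (x₀ y₀ : EuclideanSpace ℝ (Fin N)) (hx₀ : ‖x₀‖ < R) (hxy₀ : ‖x₀ - y₀‖ ≤ ρ₀) :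
    u x₀ - u y₀ ≤ (L * M₀) * (kap R x₀ * psi α (x₀ - y₀)) := by
  by_contra hcon
  push Not at hcon
  have hρ₀0 : 0 < ρ₀ := by rw [hρ₀]; linarith
  have hρ₀1 : ρ₀ ≤ 1 := by rw [hρ₀]; linarith
  obtain ⟨Φ, hΦ⟩ : ∃ Φ : EuclideanSpace ℝ (Fin N) → EuclideanSpace ℝ (Fin N) → ℝ,
    ∀ a b, Φ a b = u a - u b - (L * M₀) * (kap R a * psi α (a - b)) := ⟨_, fun _ _ => rfl⟩
  obtain ⟨η, hη⟩ : ∃ η, η = Φ x₀ y₀ := ⟨_, rfl⟩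
  have hη0 : 0 < η := by rw [hη, hΦ]; linarith
  have hyb : ∀ x y : EuclideanSpace ℝ (Fin N), ‖x‖ ≤ R → ‖x - y‖ ≤ ρ₀ → ‖y‖ ≤ (1 + R) / 2 := by
    intro x y hx hxy
    have : ‖y‖ ≤ ‖x‖ + ‖x - y‖ := by
      have := norm_sub_le x (x - y)
      rwa [sub_sub_cancel] at this
    rw [hρ₀] at hxy; linarith
  have hdiff : ∀ x y : EuclideanSpace ℝ (Fin N), ‖x‖ ≤ R → ‖x - y‖ ≤ ρ₀ → u x - u y ≤ 2 * L := by
    intro x y hx hxy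
    have h1 := hub x (by rw [mem_ball_zero_iff]; linarith)
    have h2 := hub y (by rw [mem_ball_zero_iff]; linarith [hyb x y hx hxy])
    have := le_abs_self (u x); have := neg_abs_le (u y)
    linarith
  have hLM : 0 < L * M₀ := by positivity
  have hdpos : ∀ x : EuclideanSpace ℝ (Fin N), ‖x‖ < R → 0 < R ^ 2 - ‖x‖ ^ 2 := fun x hx => by
    nlinarith [norm_nonneg x]
  have hd1 : ∀ x : EuclideanSpace ℝ (Fin N), R ^ 2 - ‖x‖ ^ 2 ≤ 1 := fun x => by
    nlinarith [norm_nonneg x]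
  have hkapd : ∀ x : EuclideanSpace ℝ (Fin N), ‖x‖ < R → kap R x * (R ^ 2 - ‖x‖ ^ 2) ^ 2 = 1 := by
    intro x hx
    have := hdpos x hx
    unfold kap; field_simp
  have hkap0 : ∀ x : EuclideanSpace ℝ (Fin N), 0 ≤ kap R x := fun x => sq_nonneg _
  -- uniform continuity
  have huc : UniformContinuousOn u (closedBall 0 ((1 + R) / 2)) :=
    (isCompact_closedBall _ _).uniformContinuousOn_of_continuous
      (hu.mono (closedBall_subset_ball (by linarith)))
  rw [Metric.uniformContinuousOn_iff] at huc
  obtain ⟨δ, hδ, huc⟩ := huc η hη0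
  obtain ⟨t, ht⟩ : ∃ t, t = min 1 (L * M₀ * δ / (4 * L)) := ⟨_, rfl⟩
  have ht0 : 0 < t := by rw [ht]; exact lt_min one_pos (by positivity)
  have ht1 : t ≤ 1 := by rw [ht]; exact min_le_left _ _
  have ht2 : t ≤ L * M₀ * δ / (4 * L) := by rw [ht]; exact min_le_right _ _
  have hout : ∀ x y : EuclideanSpace ℝ (Fin N), ‖x‖ < R → ‖x - y‖ ≤ ρ₀ → R ^ 2 - ‖x‖ ^ 2 < t →
      Φ x y < η := by
    intro x y hx hxy hdt
    have hψ := psi_ge hα (z := x - y) (hxy.trans hρ₀1)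
    have hψ0 : 0 ≤ psi α (x - y) := le_trans (by positivity) hψ
    rw [hΦ]
    rcases lt_or_ge ‖x - y‖ δ with h | h
    · have h1 := huc x (by rw [mem_closedBall_zero_iff]; linarith) y
        (by rw [mem_closedBall_zero_iff]; exact hyb x y hx.le hxy) (by rwa [dist_eq_norm])
      rw [Real.dist_eq] at h1
      have h2 := le_abs_self (u x - u y)
      have : 0 ≤ L * M₀ * (kap R x * psi α (x - y)) :=
        mul_nonneg hLM.le (mul_nonneg (hkap0 x) hψ0)
      linarith
    · have h1 := hdiff x y hx.le hxy
      have hd0 := hdpos x hx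
      obtain ⟨d, hd⟩ : ∃ d, d = R ^ 2 - ‖x‖ ^ 2 := ⟨_, rfl⟩
      rw [← hd] at hd0 hdt
      have h2 : d ^ 2 ≤ L * M₀ * δ / (4 * L) := by
        have a1 : d < 1 := hdt.trans_le ht1
        have a2 : d < L * M₀ * δ / (4 * L) := hdt.trans_le ht2
        nlinarith
      rw [le_div_iff₀ (by positivity)] at h2
      have hk := hkapd x hx
      rw [← hd] at hk
      have h3 : 4 * L ≤ kap R x * (L * M₀ * δ) := by
        calc 4 * L = kap R x * d ^ 2 * (4 * L) := by rw [hk, one_mul]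
          _ = kap R x * (d ^ 2 * (4 * L)) := by ring
          _ ≤ _ := mul_le_mul_of_nonneg_left h2 (hkap0 x)
      have h4 : kap R x * (L * M₀ * δ) ≤ kap R x * (L * M₀ * (2 * psi α (x - y))) := by
        apply mul_le_mul_of_nonneg_left _ (hkap0 x)
        apply mul_le_mul_of_nonneg_left _ hLM.le
        linarith
      linarith
  obtain ⟨Q, hQ⟩ : ∃ Q : Set (EuclideanSpace ℝ (Fin N) × EuclideanSpace ℝ (Fin N)),
    Q = {q | t ≤ R ^ 2 - ‖q.1‖ ^ 2} ∩ {q | ‖q.1 - q.2‖ ≤ ρ₀} := ⟨_, rfl⟩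
  have hQm : ∀ a b, (a, b) ∈ Q ↔ t ≤ R ^ 2 - ‖a‖ ^ 2 ∧ ‖a - b‖ ≤ ρ₀ := by
    intro a b; rw [hQ]; rfl
  have hQ2 : ∀ q ∈ Q, ‖q.1 - q.2‖ ≤ ρ₀ := fun q hq => ((hQm q.1 q.2).1 hq).2
  have hQR : ∀ q ∈ Q, ‖q.1‖ < R := by
    intro q hq
    have h1 := ((hQm q.1 q.2).1 hq).1
    nlinarith [norm_nonneg q.1]
  have hQc : IsCompact Q := by
    have hcl : IsClosed Q := by
      have k1 : Continuous (fun q : EuclideanSpace ℝ (Fin N) × EuclideanSpace ℝ (Fin N) =>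
        R ^ 2 - ‖q.1‖ ^ 2) := by fun_prop
      have k2 : Continuous (fun q : EuclideanSpace ℝ (Fin N) × EuclideanSpace ℝ (Fin N) =>
        ‖q.1 - q.2‖) := by fun_prop
      rw [hQ]
      exact (isClosed_le continuous_const k1).inter (isClosed_le k2 continuous_const)
    refine ((isCompact_closedBall (0 : EuclideanSpace ℝ (Fin N)) 1).prod
      (isCompact_closedBall (0 : EuclideanSpace ℝ (Fin N)) 1)).of_isClosed_subset hcl ?_
    intro q hq
    have h1 := hQR q hq
    have h2 := hyb q.1 q.2 h1.le (hQ2 q hq)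
    refine ⟨?_, ?_⟩ <;> rw [mem_closedBall_zero_iff] <;> linarith
  have h0Q : (x₀, y₀) ∈ Q := by
    refine (hQm _ _).2 ⟨?_, hxy₀⟩
    by_contra h
    push Not at h
    exact absurd (hout x₀ y₀ hx₀ hxy₀ h) (by rw [hη]; exact lt_irrefl _)
  have hΦc : ContinuousOn (fun q : EuclideanSpace ℝ (Fin N) × EuclideanSpace ℝ (Fin N) => Φ q.1 q.2) Q := by
    have c1 : ContinuousOn (fun q : EuclideanSpace ℝ (Fin N) × EuclideanSpace ℝ (Fin N) => u q.1) Q :=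
      hu.comp continuousOn_fst (fun q hq => by
        rw [mem_ball_zero_iff]; linarith [hQR q hq])
    have c2 : ContinuousOn (fun q : EuclideanSpace ℝ (Fin N) × EuclideanSpace ℝ (Fin N) => u q.2) Q :=
      hu.comp continuousOn_snd (fun q hq => by
        rw [mem_ball_zero_iff]; linarith [hyb q.1 q.2 (hQR q hq).le (hQ2 q hq)])
    have c3 : ContinuousOn (fun q : EuclideanSpace ℝ (Fin N) × EuclideanSpace ℝ (Fin N) => kap R q.1) Q := by
      unfold kap
      refine ContinuousOn.pow (ContinuousOn.inv₀ (by fun_prop) ?_) 2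
      intro q hq
      exact (hdpos _ (hQR q hq)).ne'
    have c4 : ContinuousOn (fun q : EuclideanSpace ℝ (Fin N) × EuclideanSpace ℝ (Fin N) =>
        psi α (q.1 - q.2)) Q :=
      ((psi_cont hα).comp (continuous_fst.sub continuous_snd)).continuousOn
    refine ContinuousOn.congr ?_ (fun q _ => hΦ q.1 q.2)
    exact (c1.sub c2).sub (continuousOn_const.mul (c3.mul c4))
  obtain ⟨⟨x, y⟩, hq, hqmax⟩ := hQc.exists_isMaxOn ⟨_, h0Q⟩ hΦc
  have hqmax' : ∀ a b, (a, b) ∈ Q → Φ a b ≤ Φ x y :=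
    fun a b hab => isMaxOn_iff.1 hqmax (a, b) hab
  have hηle : η ≤ Φ x y := by rw [hη]; exact hqmax' _ _ h0Q
  have hxR : ‖x‖ < R := hQR (x, y) hq
  have hxy : ‖x - y‖ ≤ ρ₀ := ((hQm x y).1 hq).2
  have hall : ∀ x' y' : EuclideanSpace ℝ (Fin N), ‖x'‖ < R → ‖x' - y'‖ ≤ ρ₀ → Φ x' y' ≤ Φ x y := by
    intro x' y' h1 h2
    rcases lt_or_ge (R ^ 2 - ‖x'‖ ^ 2) t with h | h
    · exact (hout x' y' h1 h2 h).le.trans hηle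
    · exact hqmax' _ _ ((hQm _ _).2 ⟨h, h2⟩)
  have hψ := psi_ge hα (z := x - y) (hxy.trans hρ₀1)
  have hρ : ‖x - y‖ ≤ 4 / M₀ * (R ^ 2 - ‖x‖ ^ 2) ^ 2 := by
    have h1 := hdiff x y hxR.le hxy
    have h2 : L * M₀ * (kap R x * psi α (x - y)) ≤ 2 * L := by
      rw [hΦ] at hηle; linarith
    have h3 : L * M₀ * (kap R x * (‖x - y‖ / 2)) ≤ 2 * L := by
      refine le_trans ?_ h2
      apply mul_le_mul_of_nonneg_left _ hLM.le
      exact mul_le_mul_of_nonneg_left hψ (hkap0 x)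
    have h4 : M₀ * (kap R x * ‖x - y‖) ≤ 4 := by
      have : L * (M₀ * (kap R x * ‖x - y‖)) ≤ L * 4 := by linarith
      exact le_of_mul_le_mul_left this hL
    rw [div_mul_eq_mul_div, le_div_iff₀ hM₀]
    have h5 := mul_le_mul_of_nonneg_right h4 (sq_nonneg (R ^ 2 - ‖x‖ ^ 2))
    have h6 : M₀ * (kap R x * ‖x - y‖) * (R ^ 2 - ‖x‖ ^ 2) ^ 2 = ‖x - y‖ * M₀ := by
      calc _ = M₀ * ‖x - y‖ * (kap R x * (R ^ 2 - ‖x‖ ^ 2) ^ 2) := by ring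
        _ = _ := by rw [hkapd x hxR]; ring
    linarith
  have hρlt : ‖x - y‖ < ρ₀ := by
    refine hρ.trans_lt ?_
    have h1 : (R ^ 2 - ‖x‖ ^ 2) ^ 2 ≤ 1 := pow_le_one₀ (hdpos x hxR).le (hd1 x)
    have h2 : 4 / M₀ < ρ₀ := by
      rw [div_lt_iff₀ hρ₀0] at hM₀ρ
      rw [div_lt_iff₀ hM₀]; linarith
    have h3 : 0 < 4 / M₀ := by positivity
    nlinarith
  have hne : x ≠ y := by
    rintro rfl
    rw [hΦ] at hηle
    have h0 : 0 ≤ psi α (x - x) := le_trans (by positivity) hψ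
    have : 0 ≤ L * M₀ * (kap R x * psi α (x - x)) := mul_nonneg hLM.le (mul_nonneg (hkap0 x) h0)
    linarith
  refine hno x y hxR (by linarith [hyb x y hxR.le hxy]) hne hρ
    ⟨min ((R - ‖x‖) / 2) ((ρ₀ - ‖x - y‖) / 2), lt_min (by linarith) (by linarith), ?_⟩
  intro ξ ζ hξ hζ
  have l1 := hξ.trans (min_le_left _ _)
  have l2 := hξ.trans (min_le_right _ _)
  have l3 := hζ.trans (min_le_right _ _)
  rw [← hΦ, ← hΦ]
  refine hall (x + ξ) (y + ζ) ?_ ?_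
  · linarith [norm_add_le x ξ]
  · have e : x + ξ - (y + ζ) = (x - y) + (ξ - ζ) := by abel
    rw [e]
    linarith [norm_add_le (x - y) (ξ - ζ), norm_sub_le ξ ζ]

end Final

/-- **Theorem 1.3 (interior Lipschitz regularity, viscosity case).**
For `p > 2` and `r < 1` there is a constant `C = C(p, N, r)` such that every bounded viscosity
solution `u` of `Σᵢ |∂ᵢu|^(p-2) ∂ᵢᵢu = f` in `B₁`, with `f` continuous on the closed unit ball,
satisfies `|u x - u y| ≤ C (‖u‖_∞ + ‖f‖_∞^(1/(p-1))) ‖x - y‖` for `x, y ∈ B_r`. -/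
theorem lipschitz_regularity_viscosity (N : ℕ) (hN : 1 ≤ N) (p : ℝ) (hp : 2 < p)
    (r : ℝ) (hr : r < 1) :
    ∃ C : ℝ, ∀ f u : EuclideanSpace ℝ (Fin N) → ℝ,
      ContinuousOn f (closedBall 0 1) →
      ContinuousOn u (ball 0 1) →
      (∃ B : ℝ, ∀ x ∈ ball (0 : EuclideanSpace ℝ (Fin N)) 1, |u x| ≤ B) →
      IsViscSubsol p (ball 0 1) u f →
      IsViscSupersol p (ball 0 1) u f →
      ∀ x ∈ ball (0 : EuclideanSpace ℝ (Fin N)) r,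
        ∀ y ∈ ball (0 : EuclideanSpace ℝ (Fin N)) r,
          |u x - u y| ≤
            C * (sSup ((fun z => |u z|) '' ball 0 1) +
                (sSup ((fun z => |f z|) '' ball 0 1)) ^ (1 / (p - 1))) * ‖x - y‖ := by
  obtain ⟨α, hα, hev⟩ := no_max hN hp
  set r' := max r 0 with hr'
  have hr'0 : 0 ≤ r' := le_max_right _ _
  have hr'1 : r' < 1 := max_lt hr one_pos
  set R := (1 + r') / 2 with hR
  have hR0 : 0 < R := by rw [hR]; linarith
  have hR1 : R < 1 := by rw [hR]; linarith
  have hrR : r' < R := by rw [hR]; linarith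
  set ρ₀ := (1 - R) / 2 with hρ₀
  have hρ₀0 : 0 < ρ₀ := by rw [hρ₀]; linarith
  obtain ⟨M₀, hM, hMρ, hM0⟩ :=
    (hev.and ((eventually_gt_atTop (4 / ρ₀)).and (eventually_gt_atTop 0))).exists
  set k₁ := ((R ^ 2 - r' ^ 2)⁻¹) ^ 2 with hk₁
  have hk₁0 : 0 ≤ k₁ := sq_nonneg _
  refine ⟨M₀ * k₁ + 2 / ρ₀, ?_⟩
  intro f u hf hu hub hsub hsup x hx y hy
  rw [mem_ball_zero_iff] at hx hy
  have h0 : (0 : EuclideanSpace ℝ (Fin N)) ∈ ball (0 : EuclideanSpace ℝ (Fin N)) 1 :=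
    mem_ball_self one_pos
  set U := sSup ((fun z => |u z|) '' ball (0 : EuclideanSpace ℝ (Fin N)) 1) with hU
  set F := sSup ((fun z => |f z|) '' ball (0 : EuclideanSpace ℝ (Fin N)) 1) with hF
  have hUb : ∀ z ∈ ball (0 : EuclideanSpace ℝ (Fin N)) 1, |u z| ≤ U := by
    intro z hz
    obtain ⟨B, hB⟩ := hub
    refine le_csSup ⟨B, ?_⟩ (mem_image_of_mem _ hz)
    rintro _ ⟨z', hz', rfl⟩
    exact hB z' hz'
  have hFb : ∀ z ∈ ball (0 : EuclideanSpace ℝ (Fin N)) 1, |f z| ≤ F := by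
    intro z hz
    obtain ⟨B, hB⟩ := (isCompact_closedBall (0 : EuclideanSpace ℝ (Fin N)) 1).exists_bound_of_continuousOn hf
    refine le_csSup ⟨B, ?_⟩ (mem_image_of_mem _ hz)
    rintro _ ⟨z', hz', rfl⟩
    exact hB z' (ball_subset_closedBall hz')
  have hU0 : 0 ≤ U := (abs_nonneg _).trans (hUb 0 h0)
  have hF0 : 0 ≤ F := (abs_nonneg _).trans (hFb 0 h0)
  set L := U + F ^ (1 / (p - 1)) with hL
  have hFp : 0 ≤ F ^ (1 / (p - 1)) := Real.rpow_nonneg hF0 _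
  have hxr : ‖x‖ < r' := hx.trans_le (le_max_left _ _)
  have hyr : ‖y‖ < r' := hy.trans_le (le_max_left _ _)
  have hx1 : x ∈ ball (0 : EuclideanSpace ℝ (Fin N)) 1 := by rw [mem_ball_zero_iff]; linarith
  have hy1 : y ∈ ball (0 : EuclideanSpace ℝ (Fin N)) 1 := by rw [mem_ball_zero_iff]; linarith
  have hux : |u x - u y| ≤ 2 * L := by
    have := abs_sub (u x) (u y)
    have := hUb x hx1
    have := hUb y hy1
    linarith
  have hL0 : 0 ≤ L := by positivity
  rcases hL0.eq_or_lt with hL0 | hL0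
  · rw [← hL0, mul_zero] at hux
    rw [← hL0, mul_zero, zero_mul]
    exact hux
  have hFL : F ≤ L ^ (p - 1) := by
    have h1 : F = (F ^ (1 / (p - 1))) ^ (p - 1) := by
      rw [← Real.rpow_mul hF0, one_div, inv_mul_cancel₀ (by linarith : p - 1 ≠ 0), Real.rpow_one]
    rw [h1]
    exact Real.rpow_le_rpow hFp (by rw [hL]; linarith) (by linarith)
  rcases le_or_gt ‖x - y‖ ρ₀ with hxy | hxy
  · have hone : ∀ a b : EuclideanSpace ℝ (Fin N), ‖a‖ < r' → ‖a - b‖ ≤ ρ₀ →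
        u a - u b ≤ (M₀ * k₁ + 2 / ρ₀) * L * ‖a - b‖ := by
      intro a b ha hab
      have h1 := max_interior hα hM0 hL0 hR0 hR1 hρ₀ hMρ hu
        (fun z hz => (hUb z hz).trans (by rw [hL]; linarith))
        (fun x y h1 h2 h3 h4 h5 => hM L F R u f x y hL0 hFL hu hFb hsub hsup hR1.le h1 h2 h3 h4 h5)
        a b (ha.trans hrR) hab
      have hk : kap R a ≤ k₁ := by
        rw [hk₁]
        unfold kap
        have hpos : 0 < R ^ 2 - r' ^ 2 := by nlinarith
        have hle : R ^ 2 - r' ^ 2 ≤ R ^ 2 - ‖a‖ ^ 2 := by nlinarith [norm_nonneg a]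
        have := inv_anti₀ hpos hle
        exact pow_le_pow_left₀ (inv_nonneg.2 (hpos.le.trans hle)) this 2
      have h2 : kap R a * psi α (a - b) ≤ k₁ * ‖a - b‖ :=
        (mul_le_mul_of_nonneg_left (psi_le α (a - b)) (sq_nonneg _)).trans
          (mul_le_mul_of_nonneg_right hk (norm_nonneg _))
      have h3 := mul_le_mul_of_nonneg_left h2 (by positivity : 0 ≤ L * M₀)
      have h4 : 0 ≤ 2 / ρ₀ * L * ‖a - b‖ := by positivity
      linarith
    rw [abs_sub_le_iff]
    refine ⟨hone x y hxr hxy, ?_⟩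
    have := hone y x hyr (by rwa [norm_sub_rev])
    rwa [norm_sub_rev y x] at this
  · refine hux.trans ?_
    have h1 : 2 * L = 2 / ρ₀ * L * ρ₀ := by field_simp
    have h2 : 2 / ρ₀ * L * ρ₀ ≤ 2 / ρ₀ * L * ‖x - y‖ := by gcongr
    have h4 : 0 ≤ M₀ * k₁ * L * ‖x - y‖ := by positivity
    linarith
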